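/- arXiv:1512.01612 — 4 statements merged into one kernel-verified Lean document; each statement's English description precedes it below -/
import Mathlib

section
/- Let n ≥ 1 and Y ∈ 𝕎^n. Define P_Y(X;t) = W(X)^{−1} · Σ_{σ ∈ S_n} Λ_Y(X;t;σ) for X ∈ 𝕎^n and t ≥ 0. Then the family of functions P_Y(X;·) satisfies the q-TAZRP master equation, and it satisfies the initial condition P_Y(Y;0) = 1 and P_Y(X;0) = 0 for every X ∈ 𝕎^n with X ≠ Y. (That is, P_Y(X;t) is the transition probability of the n-particle q-TAZRP with inhomogeneous jump rates a_i started from Y.) -/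
/-- Extended product `∏'_{k=m}^{n} f k`. -/
noncomputable def eprod (f : ℤ → ℂ) (m n : ℤ) : ℂ :=
  if m ≤ n + 1 then ∏ k ∈ Finset.Icc m n, f k
  else ∏ k ∈ Finset.Icc (n + 1) (m - 1), (f k)⁻¹

/-- `A_σ(w_1,…,w_n)`: product of `S_{(β,α)}` over inversions `(β,α)` of `σ`. -/
noncomputable def Acoef (q : ℝ) {n : ℕ} (σ : Equiv.Perm (Fin n)) (w : Fin n → ℂ) : ℂ :=
  ∏ p ∈ Finset.univ.filter
      (fun p : Fin n × Fin n => p.2 < p.1 ∧ σ⁻¹ p.1 < σ⁻¹ p.2),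
    (-((q : ℂ) * w p.1 - w p.2) / ((q : ℂ) * w p.2 - w p.1))

/-- `B(w_1,…,w_n) = ∏_{i<j} (w_i - w_j)/(w_i - q w_j)`. -/
noncomputable def Bcoef (q : ℝ) {n : ℕ} (w : Fin n → ℂ) : ℂ :=
  ∏ p ∈ Finset.univ.filter (fun p : Fin n × Fin n => p.1 < p.2),
    (w p.1 - w p.2) / (w p.1 - (q : ℂ) * w p.2)

/-- Iterated contour integral over `n` counterclockwise circles of radius `R` centred at `0`,
outermost variable first. -/
noncomputable def mcInt : (n : ℕ) → ℝ → ((Fin n → ℂ) → ℂ) → ℂ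
  | 0, _, f => f (fun i => i.elim0)
  | n + 1, R, f => ∮ z in C(0, R), mcInt n R (fun w => f (Fin.cons z w))

/-- `Λ_Y(X;t;σ)`, with all contours the counterclockwise circle of radius `R`. -/
noncomputable def Lam (q : ℝ) (b : ℤ → ℝ) {n : ℕ} (Y X : Fin n → ℤ)
    (t : ℝ) (σ : Equiv.Perm (Fin n)) (R : ℝ) : ℂ :=
  (∏ k, (-1 : ℂ) / (b (X k) : ℂ)) * (1 / (2 * Real.pi * Complex.I)) ^ n *
    mcInt n R (fun w =>
      Acoef q σ w *
        ∏ j, (eprod (fun k => (b k : ℂ) / ((b k : ℂ) - w (σ j))) (Y (σ j)) (X j) *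
          Complex.exp (-(w j) * (t : ℂ))))

/-- `R` is a valid contour radius for `Λ_Y(X;·;·)`: `R > b k` for every integer `k` in
`[min_j min(x_j, y_j) - 1, max_j max(x_j, y_j)]`. -/
def ValidR (b : ℤ → ℝ) {n : ℕ} (X Y : Fin n → ℤ) (R : ℝ) : Prop :=
  ∀ k : ℤ, (∃ j, min (X j) (Y j) - 1 ≤ k) → (∃ j, k ≤ max (X j) (Y j)) → b k < R

/-- Number of coordinates of `X` equal to `s`. -/
def cnt {n : ℕ} (X : Fin n → ℤ) (s : ℤ) : ℕ :=
  (Finset.univ.filter (fun j => X j = s)).card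

/-- The `q`-deformed factorial `[k]_q! = ∏_{j=1}^{k} (1-q^j)/(1-q)`. -/
noncomputable def qfac (q : ℝ) (k : ℕ) : ℝ :=
  ∏ j ∈ Finset.Icc 1 k, (1 - q ^ j) / (1 - q)

/-- `W(X) = ∏_i [k_i]_q!` over the distinct values of `X` with multiplicities `k_i`. -/
noncomputable def Wcoef (q : ℝ) {n : ℕ} (X : Fin n → ℤ) : ℝ :=
  ∏ s ∈ Finset.univ.image X, qfac q (cnt X s)

/-- For `X` weakly decreasing, `lowerLast X s = X^{K,-}` where the coordinate lowered by `1`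
is the last one equal to `s`. -/
def lowerLast {n : ℕ} (X : Fin n → ℤ) (s : ℤ) : Fin n → ℤ :=
  fun j => if X j = s ∧ ∀ i, j < i → X i ≠ s then X j - 1 else X j

/-- The `q`-TAZRP master equation for a family `P(X;·)`, `X ∈ 𝕎^n`. -/
def MasterEq (q : ℝ) (a : ℤ → ℝ) {n : ℕ} (P : (Fin n → ℤ) → ℝ → ℂ) : Prop :=
  ∀ X : Fin n → ℤ, Antitone X → ∀ t : ℝ, 0 ≤ t →
    HasDerivAt (P X)
      ((∑ s ∈ Finset.univ.image X,
          (1 - (q : ℂ) ^ cnt (lowerLast X s) (s - 1)) * (a (s - 1) : ℂ) * P (lowerLast X s) t) -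
        ∑ s ∈ Finset.univ.image X,
          (1 - (q : ℂ) ^ cnt X s) * (a s : ℂ) * P X t) t

/-- The tuple `X` with coordinates `k` and `k+1` (0-based) replaced by `u` and `v`. -/
def set2 {n : ℕ} (X : Fin n → ℤ) (k : ℕ) (h : k + 1 < n) (u v : ℤ) : Fin n → ℤ :=
  Function.update (Function.update X ⟨k, by omega⟩ u) ⟨k + 1, h⟩ v

/-- The free particle evolution equation. -/
def FreeEvol (b : ℤ → ℝ) {n : ℕ} (u : (Fin n → ℤ) → ℝ → ℂ) : Prop :=
  ∀ X : Fin n → ℤ, ∀ t : ℝ, 0 ≤ t →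
    HasDerivAt (u X)
      (∑ k, ((b (X k - 1) : ℂ) * u (Function.update X k (X k - 1)) t -
        (b (X k) : ℂ) * u X t)) t

/-- The boundary conditions. -/
def BoundaryCond (q : ℝ) (b : ℤ → ℝ) {n : ℕ} (u : (Fin n → ℤ) → ℝ → ℂ) : Prop :=
  ∀ (k : ℕ) (h : k + 1 < n) (X : Fin n → ℤ) (x : ℤ) (t : ℝ), 0 ≤ t →
    (b (x - 1) : ℂ) * u (set2 X k h (x - 1) x) t =
      (q : ℂ) * (b (x - 1) : ℂ) * u (set2 X k h x (x - 1)) t +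
        (1 - (q : ℂ)) * (b x : ℂ) * u (set2 X k h x x) t

/-- The explicit one-particle transition probability. -/
noncomputable def P1 (b : ℤ → ℝ) (y x : ℤ) (t : ℝ) : ℝ :=
  if x < y then 0
  else if x = y then Real.exp (-(b y) * t)
  else (∏ k ∈ Finset.Icc y (x - 1), b k) *
    ∑ k ∈ Finset.Icc y x,
      (∏ j ∈ (Finset.Icc y x).erase k, (b j - b k)⁻¹) * Real.exp (-(b k) * t)

namespace QTAZRP

open MeasureTheory Complex Filter Topology Function Metric

section Torus

variable {n : ℕ}

/-- The distinguished boundary of the polydisc with radii `R` centred at `0`. -/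
def polycircle (R : Fin n → ℝ) : Set (Fin n → ℂ) := {w | ∀ j, ‖w j‖ = R j}

lemma torusMap_mem_polycircle {R : Fin n → ℝ} (hR : ∀ j, 0 ≤ R j) (θ : Fin n → ℝ) :
    torusMap 0 R θ ∈ polycircle R := by
  intro j
  simp [torusMap, abs_of_nonneg (hR j), Complex.norm_exp]

lemma continuous_torusMap (R : Fin n → ℝ) : Continuous (torusMap 0 R) := by
  unfold torusMap
  fun_prop

lemma continuous_comp_torusMap {R : Fin n → ℝ} (hR : ∀ j, 0 ≤ R j) {f : (Fin n → ℂ) → ℂ}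
    (hf : ContinuousOn f (polycircle R)) : Continuous fun θ => f (torusMap 0 R θ) :=
  hf.comp_continuous (continuous_torusMap R) (torusMap_mem_polycircle hR)

lemma torusIntegrable_of_continuousOn {R : Fin n → ℝ} (hR : ∀ j, 0 ≤ R j)
    {f : (Fin n → ℂ) → ℂ} (hf : ContinuousOn f (polycircle R)) : TorusIntegrable f 0 R :=
  (continuous_comp_torusMap hR hf).continuousOn.integrableOn_compact isCompact_Icc

lemma torusIntegral_congr {R : Fin n → ℝ} (hR : ∀ j, 0 ≤ R j) {f g : (Fin n → ℂ) → ℂ}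
    (h : ∀ w ∈ polycircle R, f w = g w) :
    torusIntegral f 0 R = torusIntegral g 0 R := by
  unfold torusIntegral
  congr 1 with θ
  rw [h _ (torusMap_mem_polycircle hR θ)]

lemma torusIntegral_eq_inner_circleIntegral {f : (Fin (n + 1) → ℂ) → ℂ} {R : Fin (n + 1) → ℝ}
    (hf : TorusIntegrable f 0 R) (i : Fin (n + 1)) :
    torusIntegral f 0 R = torusIntegral
      (fun y => ∮ z in C(0, R i), f (i.insertNth z y)) 0 (R ∘ i.succAbove) := by
  set e : ℝ × (Fin n → ℝ) ≃ᵐ (Fin (n + 1) → ℝ) :=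
    (MeasurableEquiv.piFinSuccAbove (fun _ => ℝ) i).symm
  have hem : MeasurePreserving e :=
    (volume_preserving_piFinSuccAbove (fun _ : Fin (n + 1) => ℝ) i).symm _
  have heπ : (e ⁻¹' Set.Icc 0 fun _ => 2 * Real.pi) =
      Set.Icc 0 (2 * Real.pi) ×ˢ Set.Icc (0 : Fin n → ℝ) fun _ => 2 * Real.pi :=
    ((Fin.insertNthOrderIso (fun _ => ℝ) i).preimage_Icc _ _).trans (Set.Icc_prod_eq _ _)
  have hint := hf.function_integrable
  rw [← hem.integrableOn_comp_preimage e.measurableEmbedding, heπ, IntegrableOn,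
    Measure.volume_eq_prod, ← Measure.prod_restrict] at hint
  rw [torusIntegral, ← hem.map_eq, setIntegral_map_equiv, heπ, Measure.volume_eq_prod,
    ← Measure.prod_restrict, torusIntegral]
  refine (integral_prod_symm _ hint).trans ?_
  refine setIntegral_congr_fun measurableSet_Icc fun θ _ => ?_
  simp +unfoldPartialApp only [e, circleIntegral_def_Icc, ← integral_smul,
    deriv_circleMap, i.prod_univ_succAbove _, smul_smul, torusMap, circleMap_zero]
  refine setIntegral_congr_fun measurableSet_Icc fun Θ _ => ?_
  simp only [MeasurableEquiv.piFinSuccAbove_symm_apply, i.insertNth_apply_same,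
    i.insertNth_apply_succAbove, (· ∘ ·), Fin.insertNthEquiv, Equiv.coe_fn_mk]
  congr 1
  · exact mul_comm _ _
  · congr 1
    simp only [funext_iff, i.forall_iff_succAbove, Fin.insertNth_apply_same, zero_add,
      Fin.insertNth_apply_succAbove, imp_true_iff, and_true, Pi.zero_apply]

lemma torusIntegral_congr_of_circleIntegral {R R' : Fin n → ℝ} (hR : ∀ j, 0 ≤ R j)
    (hR' : ∀ j, 0 ≤ R' j) {f g : (Fin n → ℂ) → ℂ} (hf : ContinuousOn f (polycircle R))
    (hg : ContinuousOn g (polycircle R')) (i : Fin n) (hRR' : ∀ j, j ≠ i → R j = R' j)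
    (H : ∀ y : Fin n → ℂ, (∀ j, j ≠ i → ‖y j‖ = R j) →
      (∮ z in C(0, R i), f (update y i z)) = ∮ z in C(0, R' i), g (update y i z)) :
    torusIntegral f 0 R = torusIntegral g 0 R' := by
  cases n with
  | zero => exact i.elim0
  | succ n =>
    rw [torusIntegral_eq_inner_circleIntegral (torusIntegrable_of_continuousOn hR hf) i,
      torusIntegral_eq_inner_circleIntegral (torusIntegrable_of_continuousOn hR' hg) i]
    have hs : R ∘ i.succAbove = R' ∘ i.succAbove := by
      ext j
      exact hRR' _ (Fin.succAbove_ne i j)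
    rw [← hs]
    refine torusIntegral_congr (fun j => hR _) fun y hy => ?_
    have := H (i.insertNth 0 y) fun j hj => by
      obtain ⟨k, rfl⟩ := Fin.exists_succAbove_eq hj
      simpa using hy k
    simpa [Fin.update_insertNth] using this

lemma mcInt_eq_torusIntegral {R : ℝ} (hR : 0 ≤ R) : ∀ {n : ℕ} {f : (Fin n → ℂ) → ℂ},
    ContinuousOn f (polycircle fun _ => R) → mcInt n R f = torusIntegral f 0 fun _ => R
  | 0, f, _ => by
    rw [torusIntegral_dim0, mcInt]
    congr 1
    exact Subsingleton.elim _ _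
  | n + 1, f, hf => by
    rw [torusIntegral_succ (torusIntegrable_of_continuousOn (fun _ => hR) hf), mcInt]
    refine circleIntegral.integral_congr hR fun z hz => ?_
    refine mcInt_eq_torusIntegral hR (hf.comp (by fun_prop) fun w hw => ?_)
    intro j
    refine Fin.cases ?_ (fun k => ?_) j
    · simpa using hz
    · simpa using hw k

lemma hasDerivAt_torusIntegral_mul_exp {R : Fin n → ℝ} (hR : ∀ j, 0 ≤ R j)
    {g h : (Fin n → ℂ) → ℂ} (hg : ContinuousOn g (polycircle R))
    (hh : ContinuousOn h (polycircle R)) (t : ℝ) :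
    HasDerivAt (fun t : ℝ => torusIntegral (fun w => g w * exp (h w * t)) 0 R)
      (torusIntegral (fun w => h w * (g w * exp (h w * t))) 0 R) t := by
  have hg' := continuous_comp_torusMap hR hg
  have hh' := continuous_comp_torusMap hR hh
  set G := fun θ => g (torusMap 0 R θ)
  set K := fun θ => h (torusMap 0 R θ)
  have hc : Continuous fun θ : Fin n → ℝ => (∏ i, R i * exp (θ i * I) * I : ℂ) := by fun_prop
  set c := fun θ : Fin n → ℝ => (∏ i, R i * exp (θ i * I) * I : ℂ)
  have key := hasDerivAt_integral_of_dominated_loc_of_deriv_le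
    (μ := volume.restrict (Set.Icc (0 : Fin n → ℝ) fun _ => 2 * Real.pi))
    (F := fun (s : ℝ) θ => c θ • (G θ * exp (K θ * s)))
    (F' := fun (s : ℝ) θ => c θ • (K θ * (G θ * exp (K θ * s))))
    (bound := fun θ => ‖c θ‖ * (‖K θ‖ * (‖G θ‖ * Real.exp (‖K θ‖ * (|t| + 1)))))
    (x₀ := t) (s := ball t 1) (ball_mem_nhds t one_pos)
    (Eventually.of_forall fun s => by
      refine Continuous.aestronglyMeasurable ?_
      fun_prop)
    (by
      refine Continuous.integrableOn_Icc ?_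
      fun_prop)
    (by
      refine Continuous.aestronglyMeasurable ?_
      fun_prop)
    (Eventually.of_forall fun θ s hs => by
      rw [norm_smul, norm_mul, norm_mul]
      gcongr
      refine (norm_exp_le_exp_norm _).trans (Real.exp_le_exp.2 ?_)
      rw [norm_mul]
      gcongr
      rw [norm_real, Real.norm_eq_abs]
      rw [mem_ball, Real.dist_eq] at hs
      have := abs_sub_abs_le_abs_sub s t
      linarith)
    (by
      refine Continuous.integrableOn_Icc ?_
      fun_prop)
    (Eventually.of_forall fun θ s _ => by
      have h1 : HasDerivAt (fun s : ℝ => K θ * (s : ℂ)) (K θ) s := by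
        simpa using (hasDerivAt_id s).ofReal_comp.const_mul (K θ)
      refine ((h1.cexp.const_mul (G θ)).const_mul (c θ)).congr_deriv ?_
      rw [smul_eq_mul]
      ring)
  exact key.2

end Torus

section Circle

lemma circleIntegral_eq_of_differentiableAt_annulus {g : ℂ → ℂ} {r R : ℝ} (hr : 0 < r)
    (hrR : r ≤ R) (hg : ∀ z : ℂ, r ≤ ‖z‖ → ‖z‖ ≤ R → DifferentiableAt ℂ g z) :
    (∮ z in C(0, R), g z) = ∮ z in C(0, r), g z := by
  refine circleIntegral_eq_of_differentiable_on_annulus_off_countable hr hrR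
    Set.countable_empty (fun z hz => ?_) fun z hz => ?_
  · simp only [Set.mem_sdiff, mem_closedBall, mem_ball, dist_zero_right, not_lt] at hz
    exact (hg z hz.2 hz.1).continuousAt.continuousWithinAt
  · simp only [Set.mem_sdiff, mem_closedBall, mem_ball, dist_zero_right, not_le] at hz
    exact hg z hz.1.2.le hz.1.1.le

lemma circleIntegral_eq_zero_of_differentiableAt {g : ℂ → ℂ} {R : ℝ} (hR : 0 ≤ R)
    (hg : ∀ z : ℂ, ‖z‖ ≤ R → DifferentiableAt ℂ g z) : (∮ z in C(0, R), g z) = 0 := by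
  refine circleIntegral_eq_zero_of_differentiable_on_off_countable hR
    Set.countable_empty (fun z hz => ?_) fun z hz => ?_
  · exact (hg z (by simpa using hz)).continuousAt.continuousWithinAt
  · exact hg z (le_of_lt (by simpa using hz))

/-- A circle integral is given by the residue at infinity when the integrand is holomorphic
outside of the disc. -/
lemma circleIntegral_eq_of_tendsto_cobounded {g : ℂ → ℂ} {R : ℝ} (hR : 0 < R) {l : ℂ}
    (hg : ∀ z : ℂ, R ≤ ‖z‖ → DifferentiableAt ℂ g z)
    (hl : Tendsto (fun z => z * g z) (Bornology.cobounded ℂ) (𝓝 l)) :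
    (∮ z in C(0, R), g z) = 2 * Real.pi * I * l := by
  have hne : ∀ z : ℂ, R ≤ ‖z‖ → z ≠ 0 := fun z hz => norm_pos_iff.1 (hR.trans_le hz)
  have hinv : ∀ z : ℂ, R ≤ ‖z‖ → DifferentiableAt ℂ (fun z : ℂ => l * z⁻¹) z := fun z hz =>
    (differentiableAt_inv (hne z hz)).const_mul l
  have hci : ∀ {f : ℂ → ℂ}, (∀ z : ℂ, R ≤ ‖z‖ → DifferentiableAt ℂ f z) →
      CircleIntegrable f 0 R := fun {f} hf =>
    ContinuousOn.circleIntegrable hR.le fun z hz =>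
      (hf z (by simp at hz; exact hz.ge)).continuousAt.continuousWithinAt
  have h0 : (∮ z in C(0, R), (g z - l * z⁻¹)) = 0 := by
    refine norm_le_zero_iff.1 (le_of_forall_pos_le_add fun ε hε => ?_)
    have hlim : Tendsto (fun z => z * g z - l) (Bornology.cobounded ℂ) (𝓝 0) := by
      simpa using hl.sub_const l
    have hev := hlim.norm.eventually (gt_mem_nhds
      (show ‖(0 : ℂ)‖ < ε / (2 * Real.pi) by rw [norm_zero]; positivity))
    rw [hasBasis_cobounded_norm.eventually_iff] at hev
    obtain ⟨M, -, hM⟩ := hev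
    set R' := max R M
    have hR' : 0 < R' := hR.trans_le (le_max_left _ _)
    rw [← circleIntegral_eq_of_differentiableAt_annulus (g := fun z => g z - l * z⁻¹) (R := R')
      hR (le_max_left _ _)
      fun z hz _ => (hg z hz).sub (hinv z hz)]
    refine (circleIntegral.norm_integral_le_of_norm_le_const hR'.le
      (C := ε / (2 * Real.pi) / R') fun z hz => ?_).trans ?_
    · have hz' : ‖z‖ = R' := by simpa using hz
      have hz0 : z ≠ 0 := norm_pos_iff.1 (hz' ▸ hR')
      have := (hM (x := z) (by simp [hz', R'])).le
      rw [le_div_iff₀ hR', ← hz', mul_comm, ← norm_mul, mul_sub, mul_left_comm,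
        mul_inv_cancel₀ hz0, mul_one]
      exact this
    · rw [zero_add]
      refine le_of_eq ?_
      field_simp
  rw [circleIntegral.integral_sub (hci hg) (hci hinv), sub_eq_zero] at h0
  rw [h0, circleIntegral.integral_const_mul, mul_comm]
  congr 1
  simpa using circleIntegral.integral_sub_center_inv 0 hR.ne'

lemma tendsto_inv_sub_cobounded (c : ℂ) :
    Tendsto (fun z : ℂ => (z - c)⁻¹) (Bornology.cobounded ℂ) (𝓝 0) :=
  tendsto_inv₀_cobounded.comp (tendsto_sub_const_cobounded c)

lemma eventually_sub_ne_zero_cobounded (c : ℂ) :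
    ∀ᶠ z : ℂ in Bornology.cobounded ℂ, z - c ≠ 0 :=
  (tendsto_sub_const_cobounded c).eventually_ne_cobounded 0

lemma tendsto_mul_inv_sub_cobounded (c : ℂ) :
    Tendsto (fun z : ℂ => z * (z - c)⁻¹) (Bornology.cobounded ℂ) (𝓝 1) := by
  have h : Tendsto (fun z : ℂ => 1 + c * (z - c)⁻¹) (Bornology.cobounded ℂ) (𝓝 (1 + c * 0)) :=
    ((tendsto_inv_sub_cobounded c).const_mul c).const_add 1
  rw [mul_zero, add_zero] at h
  refine h.congr' ((eventually_sub_ne_zero_cobounded c).mono fun z hz => ?_)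
  field_simp
  ring

lemma tendsto_scattering_cobounded (q u : ℂ) :
    Tendsto (fun z : ℂ => -(q * z - u) / (q * u - z)) (Bornology.cobounded ℂ) (𝓝 q) := by
  have h : Tendsto (fun z : ℂ => q * (z * (z - q * u)⁻¹) - u * (z - q * u)⁻¹)
      (Bornology.cobounded ℂ) (𝓝 (q * 1 - u * 0)) :=
    ((tendsto_mul_inv_sub_cobounded _).const_mul q).sub
      ((tendsto_inv_sub_cobounded _).const_mul u)
  rw [mul_one, mul_zero, sub_zero] at h
  refine h.congr fun z => ?_
  rw [← neg_sub z (q * u), neg_div_neg_eq]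
  ring

end Circle

section TorusVanishing

variable {n : ℕ}

lemma torusIntegral_eq_zero_of_circleIntegral {R : Fin n → ℝ} (hR : ∀ j, 0 ≤ R j)
    {f : (Fin n → ℂ) → ℂ} (hf : ContinuousOn f (polycircle R)) (i : Fin n)
    (H : ∀ y : Fin n → ℂ, (∀ j, j ≠ i → ‖y j‖ = R j) →
      (∮ z in C(0, R i), f (update y i z)) = 0) :
    torusIntegral f 0 R = 0 := by
  rw [torusIntegral_congr_of_circleIntegral (g := fun _ => 0) hR hR hf continuousOn_const i
    (fun _ _ => rfl) fun y hy => by rw [H y hy]; simp [circleIntegral]]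
  simp [torusIntegral]

end TorusVanishing

section Factor

/-- The factor `∏'_{k=y}^{x} b_k / (b_k - z)` of the Bethe integrand. -/
noncomputable def siteFactor (b : ℤ → ℝ) (y x : ℤ) (z : ℂ) : ℂ :=
  eprod (fun k => (b k : ℂ) / ((b k : ℂ) - z)) y x

variable {b : ℤ → ℝ} {y x : ℤ}

lemma siteFactor_of_le {z : ℂ} (h : y ≤ x + 1) :
    siteFactor b y x z = ∏ k ∈ Finset.Icc y x, (b k : ℂ) / ((b k : ℂ) - z) := by
  rw [siteFactor, eprod, if_pos h]

lemma siteFactor_of_lt {z : ℂ} (h : x + 1 < y) :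
    siteFactor b y x z = ∏ k ∈ Finset.Icc (x + 1) (y - 1), ((b k : ℂ) - z) / (b k : ℂ) := by
  rw [siteFactor, eprod, if_neg (not_le.2 h)]
  simp only [inv_div]

lemma siteFactor_self (z : ℂ) : siteFactor b y y z = (b y : ℂ) / ((b y : ℂ) - z) := by
  rw [siteFactor_of_le (by lia), Finset.Icc_self, Finset.prod_singleton]

lemma differentiableAt_siteFactor {z : ℂ} (hz : ∀ k, y ≤ k → k ≤ x → z ≠ b k) :
    DifferentiableAt ℂ (siteFactor b y x) z := by
  rcases le_or_gt y (x + 1) with h | h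
  · rw [show siteFactor b y x = fun z => _ from funext fun z => siteFactor_of_le h]
    refine DifferentiableAt.fun_finsetProd fun k hk => ?_
    rw [Finset.mem_Icc] at hk
    exact (differentiableAt_const _).div (by fun_prop) (sub_ne_zero.2 (hz k hk.1 hk.2).symm)
  · rw [show siteFactor b y x = fun z => _ from funext fun z => siteFactor_of_lt h]
    fun_prop

lemma siteFactor_pred {z : ℂ} (hb : b x ≠ 0) (hz : z ≠ b x) :
    siteFactor b y (x - 1) z = siteFactor b y x z * (((b x : ℂ) - z) / b x) := by
  have hb' : (b x : ℂ) ≠ 0 := by exact_mod_cast hb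
  have hz' : (b x : ℂ) - z ≠ 0 := sub_ne_zero.2 hz.symm
  rcases lt_trichotomy y (x + 1) with h | h | h
  · rw [siteFactor_of_le (by lia), siteFactor_of_le (by lia),
      show Finset.Icc y x = insert x (Finset.Icc y (x - 1)) by ext k; simp; lia,
      Finset.prod_insert (by simp)]
    field_simp
  · subst h
    rw [siteFactor_of_lt (by lia), siteFactor_of_le (by lia)]
    simp
  · rw [siteFactor_of_lt (by lia), siteFactor_of_lt (by lia),
      show Finset.Icc (x - 1 + 1) (y - 1) = insert x (Finset.Icc (x + 1) (y - 1)) by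
        ext k; simp; lia,
      Finset.prod_insert (by simp), mul_comm]

lemma tendsto_mul_siteFactor (h : y < x) :
    Tendsto (fun z => z * siteFactor b y x z) (Bornology.cobounded ℂ) (𝓝 0) := by
  have h1 : ∀ c : ℂ, Tendsto (fun z : ℂ => c / (c - z)) (Bornology.cobounded ℂ) (𝓝 0) := by
    intro c
    have := (tendsto_inv_sub_cobounded c).const_mul (-c)
    rw [mul_zero] at this
    refine this.congr fun z => ?_
    rw [← neg_sub z c, div_neg, div_eq_mul_inv, neg_mul]
  have h2 : ∀ c : ℂ, Tendsto (fun z : ℂ => z * (c / (c - z))) (Bornology.cobounded ℂ)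
      (𝓝 (-c)) := by
    intro c
    have := (tendsto_mul_inv_sub_cobounded c).const_mul (-c)
    rw [mul_one] at this
    refine this.congr fun z => ?_
    rw [← neg_sub z c, div_neg, div_eq_mul_inv]
    ring
  have h3 := (h2 (b y)).mul (tendsto_finsetProd (Finset.Icc (y + 1) x) fun k _ => h1 (b k))
  rw [Finset.prod_eq_zero (i := x) (by simp; lia) rfl, mul_zero] at h3
  refine h3.congr fun z => ?_
  rw [siteFactor_of_le (by lia),
    show Finset.Icc y x = insert y (Finset.Icc (y + 1) x) by ext k; simp; lia,
    Finset.prod_insert (by simp), mul_assoc]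

end Factor

section Algebra

variable {n : ℕ}

lemma swap_lt_swap_iff {k k' : Fin n} (hk : k.val + 1 = k'.val) {x y : Fin n}
    (h : ¬(x = k' ∧ y = k)) (h' : ¬(x = k ∧ y = k')) :
    Equiv.swap k k' x < Equiv.swap k k' y ↔ x < y := by
  simp only [Equiv.swap_apply_def, Fin.lt_def, Fin.ext_iff] at *
  split_ifs <;> lia

lemma Acoef_mul_swap (q : ℝ) (σ : Equiv.Perm (Fin n)) (w : Fin n → ℂ) {k k' : Fin n}
    (hk : k.val + 1 = k'.val) (hσ : σ k < σ k') :
    Acoef q (σ * Equiv.swap k k') w =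
      -((q : ℂ) * w (σ k') - w (σ k)) / ((q : ℂ) * w (σ k) - w (σ k')) * Acoef q σ w := by
  have hkk : k < k' := by simp [Fin.lt_def, ← hk]
  unfold Acoef
  have hset : Finset.univ.filter (fun p : Fin n × Fin n => p.2 < p.1 ∧
        (σ * Equiv.swap k k')⁻¹ p.1 < (σ * Equiv.swap k k')⁻¹ p.2) =
      insert (σ k', σ k) (Finset.univ.filter
        (fun p : Fin n × Fin n => p.2 < p.1 ∧ σ⁻¹ p.1 < σ⁻¹ p.2)) := by
    ext ⟨u, v⟩
    obtain ⟨x, rfl⟩ := σ.surjective u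
    obtain ⟨y, rfl⟩ := σ.surjective v
    simp only [Finset.mem_filter, Finset.mem_univ, true_and, mul_inv_rev, Equiv.swap_inv,
      Equiv.Perm.mul_apply, Equiv.Perm.coe_inv, Equiv.symm_apply_apply, Finset.mem_insert,
      Prod.mk.injEq, EmbeddingLike.apply_eq_iff_eq]
    by_cases h : x = k' ∧ y = k
    · obtain ⟨rfl, rfl⟩ := h
      simp [hσ, hkk]
    · by_cases h' : x = k ∧ y = k'
      · obtain ⟨rfl, rfl⟩ := h'
        simp [hσ.not_gt, hkk.ne]
      · rw [swap_lt_swap_iff hk h h']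
        simp [h]
  rw [hset, Finset.prod_insert (by simp [hkk.le])]

/-- The Bethe integrand of `Lam` at time zero, without its prefactors. -/
noncomputable def betheIntegrand (q : ℝ) (b : ℤ → ℝ) (Y X : Fin n → ℤ)
    (σ : Equiv.Perm (Fin n)) (w : Fin n → ℂ) : ℂ :=
  Acoef q σ w * ∏ j, siteFactor b (Y (σ j)) (X j) (w (σ j))

variable {q : ℝ} {b : ℤ → ℝ} {Y X : Fin n → ℤ} {w : Fin n → ℂ}

lemma betheIntegrand_add_swap (hw : ∀ α β, α < β → (q : ℂ) * w α ≠ w β)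
    {k k' : Fin n} (hk : k.val + 1 = k'.val) (hX : X k = X k') (σ : Equiv.Perm (Fin n))
    (hσ : σ k < σ k') :
    betheIntegrand q b Y X σ w * (w (σ k) - q * w (σ k')) +
      betheIntegrand q b Y X (σ * Equiv.swap k k') w * (w (σ k') - q * w (σ k)) = 0 := by
  have hprod : ∏ j, siteFactor b (Y ((σ * Equiv.swap k k') j)) (X j)
        (w ((σ * Equiv.swap k k') j)) =
      ∏ j, siteFactor b (Y (σ j)) (X j) (w (σ j)) := by
    rw [← Equiv.prod_comp (Equiv.swap k k')]
    refine Finset.prod_congr rfl fun j _ => ?_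
    have hXj : X (Equiv.swap k k' j) = X j := by
      rcases eq_or_ne j k with rfl | h
      · rw [Equiv.swap_apply_left, hX]
      · rcases eq_or_ne j k' with rfl | h'
        · rw [Equiv.swap_apply_right, hX]
        · rw [Equiv.swap_apply_of_ne_of_ne h h']
    simp [hXj]
  have hne : (q : ℂ) * w (σ k) - w (σ k') ≠ 0 := sub_ne_zero.2 (hw _ _ hσ)
  rw [betheIntegrand, betheIntegrand, hprod, Acoef_mul_swap q σ w hk hσ]
  generalize Acoef q σ w = A, ∏ j, siteFactor b (Y (σ j)) (X j) (w (σ j)) = P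
  have key := div_mul_cancel₀ (-((q : ℂ) * w (σ k') - w (σ k))) hne
  linear_combination (-(A * P)) * key

lemma sum_betheIntegrand_mul_sub_eq_zero (hw : ∀ α β, α < β → (q : ℂ) * w α ≠ w β)
    {k k' : Fin n} (hk : k.val + 1 = k'.val) (hX : X k = X k') :
    ∑ σ : Equiv.Perm (Fin n),
      betheIntegrand q b Y X σ w * (w (σ k) - q * w (σ k')) = 0 := by
  set T := fun σ : Equiv.Perm (Fin n) =>
    betheIntegrand q b Y X σ w * (w (σ k) - q * w (σ k')) with hT
  have hpair : ∀ σ, T σ + T (σ * Equiv.swap k k') = 0 := by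
    intro σ
    have hkk : k ≠ k' := by
      rintro rfl
      lia
    rcases lt_or_gt_of_ne (σ.injective.ne hkk) with h | h
    · simpa [hT] using betheIntegrand_add_swap (b := b) (Y := Y) hw hk hX σ h
    · have := betheIntegrand_add_swap (b := b) (Y := Y) hw hk hX
        (σ * Equiv.swap k k') (by simpa using h)
      rw [add_comm]
      simpa [hT, mul_assoc] using this
  have h2 : ∑ σ, T σ + ∑ σ, T σ = 0 := by
    nth_rewrite 2 [← Equiv.sum_comp (Equiv.mulRight (Equiv.swap k k')) T]
    rw [← Finset.sum_add_distrib]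
    exact Finset.sum_eq_zero fun σ _ => hpair σ
  exact add_self_eq_zero.1 h2

/-- A sequence that is geometric along a cluster of `X` sums to a `q`-integer times its
last entry. -/
lemma sum_cluster_eq (q : ℂ) (hX : Antitone X) {V : Fin n → ℂ}
    (hV : ∀ k k' : Fin n, k.val + 1 = k'.val → X k = X k' → V k = q * V k')
    {s : ℤ} {l : Fin n} (hl : X l = s) (hlast : ∀ i, l < i → X i ≠ s) :
    (1 - q) * ∑ k ∈ Finset.univ.filter (fun k => X k = s), V k =
      (1 - q ^ cnt X s) * V l := by
  have hpow : ∀ (d : ℕ) (k : Fin n), k.val + d = l.val → X k = s → V k = q ^ d * V l := by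
    intro d
    induction d with
    | zero =>
      intro k hk _
      rw [Fin.ext (a := k) (b := l) (by lia), pow_zero, one_mul]
    | succ d ih =>
      intro k hk hks
      have hk' : k.val + 1 < n := by lia
      have h1 : X ⟨k.val + 1, hk'⟩ ≤ X k := hX (by simp [Fin.le_def])
      have h2 : X l ≤ X ⟨k.val + 1, hk'⟩ := hX (by simp only [Fin.le_def]; lia)
      have h3 : X ⟨k.val + 1, hk'⟩ = s := by lia
      rw [hV k ⟨k.val + 1, hk'⟩ rfl (by rw [h3, hks]), ih ⟨k.val + 1, hk'⟩ (by simp; lia) h3]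
      ring
  set S := Finset.univ.filter (fun k => X k = s) with hS
  have hlS : l ∈ S := by simp [hS, hl]
  set f := S.min' ⟨l, hlS⟩ with hf
  have hfS : X f = s := by
    have := S.min'_mem ⟨l, hlS⟩
    simpa [hS] using this
  have hle : ∀ k ∈ S, k ≤ l := fun k hk => by
    by_contra! h
    exact hlast k h (by simpa [hS] using hk)
  have hge : ∀ k ∈ S, f ≤ k := fun k hk => S.min'_le k hk
  have hfl := hge l hlS
  have hinj : Set.InjOn (fun k : Fin n => l.val - k.val) S := by
    intro x hx y hy hxy
    have h1 := hle x hx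
    have h2 := hle y hy
    simp only [Fin.le_def, Fin.ext_iff] at *
    lia
  have himg : S.image (fun k : Fin n => l.val - k.val) = Finset.range (l.val - f.val + 1) := by
    ext m
    simp only [Finset.mem_image, Finset.mem_range]
    constructor
    · rintro ⟨k, hk, rfl⟩
      have := hge k hk
      simp only [Fin.le_def] at this
      lia
    · intro hm
      have hm' : l.val - m < n := by lia
      rw [Fin.le_def] at hfl
      refine ⟨⟨l.val - m, hm'⟩, ?_, by simp; lia⟩
      have h1 : X ⟨l.val - m, hm'⟩ ≤ X f := hX (by simp only [Fin.le_def]; lia)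
      have h2 : X l ≤ X ⟨l.val - m, hm'⟩ := hX (by simp [Fin.le_def])
      simp only [hS, Finset.mem_filter, Finset.mem_univ, true_and]
      lia
  have hcard : cnt X s = l.val - f.val + 1 := by
    rw [cnt, ← hS, ← Finset.card_image_of_injOn hinj, himg, Finset.card_range]
  have hsum : ∑ k ∈ S, V k = ∑ m ∈ S.image (fun k : Fin n => l.val - k.val), q ^ m * V l := by
    rw [Finset.sum_image hinj]
    refine Finset.sum_congr rfl fun k hk => hpow _ k ?_ (by simpa [hS] using hk)
    have := hle k hk
    rw [Fin.le_def] at this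
    lia
  rw [hsum, himg, hcard, ← Finset.sum_mul, ← mul_assoc, mul_neg_geom_sum]

lemma exists_last (X : Fin n → ℤ) {s : ℤ} (hs : s ∈ Finset.univ.image X) :
    ∃ l, X l = s ∧ ∀ i, l < i → X i ≠ s := by
  obtain ⟨k, -, hk⟩ := Finset.mem_image.1 hs
  have hne : (Finset.univ.filter (fun k => X k = s)).Nonempty := ⟨k, by simp [hk]⟩
  refine ⟨_, by simpa using Finset.max'_mem _ hne, fun i hi his => hi.not_ge ?_⟩
  exact Finset.le_max' _ _ (by simp [his])

lemma lowerLast_eq_update {s : ℤ} {l : Fin n} (hl : X l = s)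
    (hlast : ∀ i, l < i → X i ≠ s) : lowerLast X s = update X l (X l - 1) := by
  ext j
  rw [lowerLast]
  rcases eq_or_ne j l with rfl | hj
  · rw [if_pos ⟨hl, hlast⟩, update_self]
  · rw [if_neg, update_of_ne hj]
    rintro ⟨h1, h2⟩
    rcases lt_or_gt_of_ne hj with h | h
    · exact h2 l h hl
    · exact hlast j h h1

/-- The prefactor `∏_k (-1 / b_{x_k})`. -/
noncomputable def sitePrefactor (b : ℤ → ℝ) (X : Fin n → ℤ) : ℂ := ∏ k, (-1 : ℂ) / (b (X k) : ℂ)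

lemma mul_betheIntegrand_update (hb : ∀ i, 0 < b i) (σ : Equiv.Perm (Fin n)) (l : Fin n)
    (hw : w (σ l) ≠ b (X l)) :
    (b (X l - 1) : ℂ) * (sitePrefactor b (update X l (X l - 1)) *
        betheIntegrand q b Y (update X l (X l - 1)) σ w) =
      ((b (X l) : ℂ) - w (σ l)) * (sitePrefactor b X * betheIntegrand q b Y X σ w) := by
  have hb' : ∀ i, (b i : ℂ) ≠ 0 := fun i => by exact_mod_cast (hb i).ne'
  have hpre : (b (X l - 1) : ℂ) * sitePrefactor b (update X l (X l - 1)) =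
      (b (X l) : ℂ) * sitePrefactor b X := by
    unfold sitePrefactor
    rw [← Finset.mul_prod_erase _ _ (Finset.mem_univ l), update_self,
      ← Finset.mul_prod_erase Finset.univ (fun k => (-1 : ℂ) / (b (X k) : ℂ))
        (Finset.mem_univ l)]
    rw [Finset.prod_congr rfl fun k hk => by rw [update_of_ne (Finset.ne_of_mem_erase hk)]]
    have h1 := hb' (X l - 1)
    have h2 := hb' (X l)
    field_simp
  have hprod : ∏ j, siteFactor b (Y (σ j)) (update X l (X l - 1) j) (w (σ j)) =
      (((b (X l) : ℂ) - w (σ l)) / b (X l)) *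
        ∏ j, siteFactor b (Y (σ j)) (X j) (w (σ j)) := by
    rw [← Finset.mul_prod_erase _ _ (Finset.mem_univ l), update_self,
      ← Finset.mul_prod_erase Finset.univ (fun j => siteFactor b (Y (σ j)) (X j) (w (σ j)))
        (Finset.mem_univ l), siteFactor_pred (hb _).ne' hw]
    rw [Finset.prod_congr rfl fun k hk => by rw [update_of_ne (Finset.ne_of_mem_erase hk)]]
    ring
  rw [betheIntegrand, betheIntegrand, hprod, ← mul_assoc, hpre]
  have h2 := hb' (X l)
  field_simp

/-- The integrand of `∑ σ, Lam q b Y X 0 σ R`. -/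
noncomputable def betheSum (q : ℝ) (b : ℤ → ℝ) (Y X : Fin n → ℤ) (w : Fin n → ℂ) : ℂ :=
  ∑ σ : Equiv.Perm (Fin n), sitePrefactor b X * betheIntegrand q b Y X σ w

/-- Pointwise form of the master equation for the Bethe integrand. -/
lemma neg_sum_mul_betheSum {a : ℤ → ℝ} (hq : q < 1) (hb : ∀ i, 0 < b i)
    (hab : ∀ i, b i = a i * (1 - q)) (hX : Antitone X)
    (hw : ∀ α β, α < β → (q : ℂ) * w α ≠ w β) (hwX : ∀ i j, w i ≠ b (X j)) :
    -(∑ j, w j) * betheSum q b Y X w =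
      ∑ s ∈ Finset.univ.image X, (1 - (q : ℂ) ^ cnt X s) *
        ((a (s - 1) : ℂ) * betheSum q b Y (lowerLast X s) w -
          (a s : ℂ) * betheSum q b Y X w) := by
  set V : Fin n → ℂ := fun k => ∑ σ : Equiv.Perm (Fin n),
    sitePrefactor b X * betheIntegrand q b Y X σ w * w (σ k) with hVdef
  have hV : ∀ k k' : Fin n, k.val + 1 = k'.val → X k = X k' → V k = q * V k' := by
    intro k k' hk hkk
    have := sum_betheIntegrand_mul_sub_eq_zero (b := b) (Y := Y) hw hk hkk
    rw [← sub_eq_zero, hVdef]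
    simp only [Finset.mul_sum]
    rw [← Finset.sum_sub_distrib]
    rw [← mul_zero (sitePrefactor b X), ← this, Finset.mul_sum]
    refine Finset.sum_congr rfl fun σ _ => ?_
    ring
  have hsumV : (∑ j, w j) * betheSum q b Y X w = ∑ k, V k := by
    simp only [hVdef, betheSum]
    rw [Finset.sum_comm, Finset.mul_sum]
    refine Finset.sum_congr rfl fun σ _ => ?_
    rw [← Finset.mul_sum, Equiv.sum_comp σ w, mul_comm]
  rw [neg_mul, hsumV, ← Finset.sum_fiberwise_of_maps_to (t := Finset.univ.image X) (g := X)
    (fun k _ => Finset.mem_image_of_mem X (Finset.mem_univ k)), ← Finset.sum_neg_distrib]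
  refine Finset.sum_congr rfl fun s hs => ?_
  obtain ⟨l, hl, hlast⟩ := exists_last X hs
  have hgeom := sum_cluster_eq (q : ℂ) hX hV hl hlast
  have hq1 : (1 - (q : ℂ)) ≠ 0 := by
    have : (1 - q) ≠ 0 := by linarith
    exact_mod_cast this
  have hlow : (b (s - 1) : ℂ) * betheSum q b Y (lowerLast X s) w =
      (b s : ℂ) * betheSum q b Y X w - V l := by
    rw [lowerLast_eq_update hl hlast, betheSum, betheSum, hVdef, Finset.mul_sum,
      Finset.mul_sum]
    simp only
    rw [← Finset.sum_sub_distrib]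
    refine Finset.sum_congr rfl fun σ _ => ?_
    have := mul_betheIntegrand_update (q := q) (Y := Y) hb σ l (hwX (σ l) l)
    rw [hl] at this ⊢
    rw [this]
    ring
  have hb1 : (b (s - 1) : ℂ) = a (s - 1) * (1 - q) := by exact_mod_cast hab (s - 1)
  have hb2 : (b s : ℂ) = a s * (1 - q) := by exact_mod_cast hab s
  refine mul_left_cancel₀ hq1 ?_
  rw [mul_neg, hgeom]
  rw [hb1, hb2] at hlow
  linear_combination (-(1 - (q : ℂ) ^ cnt X s)) * hlow

end Algebra

section Weights

variable {n : ℕ} {q : ℝ} {X : Fin n → ℤ}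

lemma qfac_zero : qfac q 0 = 1 := by simp [qfac]

lemma qfac_succ (k : ℕ) : qfac q (k + 1) = qfac q k * ((1 - q ^ (k + 1)) / (1 - q)) := by
  rw [qfac, Finset.prod_Icc_succ_top (by lia), qfac]

lemma qfac_pos (hq : q ∈ Set.Ioo (0 : ℝ) 1) (k : ℕ) : 0 < qfac q k := by
  refine Finset.prod_pos fun j hj => div_pos ?_ (by linarith [hq.2])
  rw [Finset.mem_Icc] at hj
  linarith [pow_lt_one₀ hq.1.le hq.2 (show j ≠ 0 by lia)]

lemma Wcoef_pos (hq : q ∈ Set.Ioo (0 : ℝ) 1) (X : Fin n → ℤ) : 0 < Wcoef q X :=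
  Finset.prod_pos fun _ _ => qfac_pos hq _

lemma cnt_eq_zero_of_notMem {s : ℤ} (hs : s ∉ Finset.univ.image X) : cnt X s = 0 := by
  rw [cnt, Finset.card_eq_zero, Finset.filter_eq_empty_iff]
  exact fun j _ hj => hs (Finset.mem_image.2 ⟨j, Finset.mem_univ j, hj⟩)

lemma Wcoef_eq_prod_of_subset {T : Finset ℤ} (hT : Finset.univ.image X ⊆ T) :
    Wcoef q X = ∏ s ∈ T, qfac q (cnt X s) :=
  Finset.prod_subset hT fun s _ hs => by rw [cnt_eq_zero_of_notMem hs, qfac_zero]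

lemma cnt_eq_sum (X : Fin n → ℤ) (r : ℤ) : cnt X r = ∑ j, if X j = r then 1 else 0 := by
  rw [cnt, Finset.card_filter]

lemma cnt_update_add (l : Fin n) (v r : ℤ) :
    cnt (update X l v) r + (if X l = r then 1 else 0) =
      cnt X r + (if v = r then 1 else 0) := by
  rw [cnt_eq_sum, cnt_eq_sum, ← Finset.add_sum_erase _ _ (Finset.mem_univ l), update_self,
    ← Finset.add_sum_erase Finset.univ (fun j => if X j = r then 1 else 0) (Finset.mem_univ l),
    Finset.sum_congr rfl fun k hk => by rw [update_of_ne (Finset.ne_of_mem_erase hk)]]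
  lia

lemma Wcoef_update_pred (q : ℝ) (X : Fin n → ℤ) (l : Fin n) :
    Wcoef q (update X l (X l - 1)) * (1 - q ^ cnt X (X l)) =
      Wcoef q X * (1 - q ^ cnt (update X l (X l - 1)) (X l - 1)) := by
  set X' := update X l (X l - 1) with hX'
  set s := X l with hs
  set T := insert s (insert (s - 1) (Finset.univ.image X ∪ Finset.univ.image X'))
  have hsT : s ∈ T := by simp [T]
  have hsT' : s - 1 ∈ T.erase s := by simp [T]
  have hc : ∀ r, cnt X' r + (if s = r then 1 else 0) = cnt X r + (if s - 1 = r then 1 else 0) :=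
    cnt_update_add l (s - 1)
  have h1 := hc s
  have h2 := hc (s - 1)
  simp only [if_true, show s - 1 ≠ s by lia, show s ≠ s - 1 by lia, if_false, add_zero] at h1 h2
  have hrest : ∏ r ∈ (T.erase s).erase (s - 1), qfac q (cnt X' r) =
      ∏ r ∈ (T.erase s).erase (s - 1), qfac q (cnt X r) := by
    refine Finset.prod_congr rfl fun r hr => ?_
    have h3 := hc r
    have hr1 : r ≠ s - 1 := Finset.ne_of_mem_erase hr
    have hr2 : r ≠ s := Finset.ne_of_mem_erase (Finset.mem_of_mem_erase hr)
    rw [if_neg hr1.symm, if_neg hr2.symm, add_zero, add_zero] at h3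
    rw [h3]
  rw [Wcoef_eq_prod_of_subset (T := T) (X := X') (by simp only [T]; grind),
    Wcoef_eq_prod_of_subset (T := T) (X := X) (by simp only [T]; grind),
    ← Finset.mul_prod_erase T _ hsT, ← Finset.mul_prod_erase T _ hsT,
    ← Finset.mul_prod_erase _ _ hsT', ← Finset.mul_prod_erase _ _ hsT', hrest,
    ← h1, h2, qfac_succ, qfac_succ]
  ring

end Weights

section Contours

variable {n : ℕ}

/-- Contours can be enlarged simultaneously as long as the integrand is holomorphic where the
moduli of the variables are weakly increasing. -/
lemma torusIntegral_eq_of_radius_le {f : (Fin n → ℂ) → ℂ} {R R' : ℝ} (hR : 0 < R)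
    (hRR' : R ≤ R') (hf : ∀ w : Fin n → ℂ, (Monotone fun j => ‖w j‖) → (∀ j, R ≤ ‖w j‖) →
      DifferentiableAt ℂ f w) :
    torusIntegral f 0 (fun _ => R') = torusIntegral f 0 fun _ => R := by
  set ρ : ℕ → Fin n → ℝ := fun m j => if m ≤ j.val then R' else R with hρ
  have hρpos : ∀ m j, 0 ≤ ρ m j := fun m j => by
    simp only [hρ]
    split_ifs <;> linarith
  have hcont : ∀ m, ContinuousOn f (polycircle (ρ m)) := by
    intro m w hw
    refine (hf w (fun i j hij => ?_) fun j => ?_).continuousAt.continuousWithinAt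
    · rw [Fin.le_def] at hij
      simp only [hw i, hw j, hρ]
      split_ifs <;> linarith
    · rw [hw j]
      simp only [hρ]
      split_ifs <;> linarith
  have hstep : ∀ m, m < n → torusIntegral f 0 (ρ m) = torusIntegral f 0 (ρ (m + 1)) := by
    intro m hm
    refine torusIntegral_congr_of_circleIntegral (hρpos _) (hρpos _) (hcont _) (hcont _) ⟨m, hm⟩
      (fun j hj => ?_) fun y hy => ?_
    · have hj' : j.val ≠ m := fun h => hj (Fin.ext h)
      simp only [hρ, show (m ≤ j.val ↔ m + 1 ≤ j.val) by lia]
    · have h1 : ρ m ⟨m, hm⟩ = R' := by simp [hρ]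
      have h2 : ρ (m + 1) ⟨m, hm⟩ = R := by simp [hρ]
      rw [h1, h2]
      refine circleIntegral_eq_of_differentiableAt_annulus hR hRR' fun z hz hz' => ?_
      have hnorm : ∀ j, ‖update y ⟨m, hm⟩ z j‖ =
          if j = ⟨m, hm⟩ then ‖z‖ else if m ≤ j.val then R' else R := by
        intro j
        split_ifs with h h'
        · rw [h, update_self]
        · rw [update_of_ne h, hy j h]
          simp [hρ, h']
        · rw [update_of_ne h, hy j h]
          simp [hρ, h']
      refine DifferentiableAt.comp z (hf _ (fun i j hij => ?_) fun j => ?_)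
        (hasDerivAt_update y ⟨m, hm⟩ z).differentiableAt
      · rw [Fin.le_def] at hij
        simp only [hnorm, Fin.ext_iff]
        split_ifs <;> first | linarith | lia
      · rw [hnorm]
        split_ifs <;> linarith
  have hall : ∀ m, m ≤ n → torusIntegral f 0 (ρ 0) = torusIntegral f 0 (ρ m) := by
    intro m
    induction m with
    | zero => exact fun _ => rfl
    | succ m ih => exact fun hm => (ih (by lia)).trans (hstep m hm)
  have h0 : ρ 0 = fun _ => R' := by simp [hρ]
  have hn : ρ n = fun _ => R := by
    ext j
    simp [hρ]
  rw [← h0, hall n le_rfl, hn]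

lemma torusIntegral_finset_sum {ι : Type*} (s : Finset ι) {R : Fin n → ℝ} (hR : ∀ j, 0 ≤ R j)
    {f : ι → (Fin n → ℂ) → ℂ} (hf : ∀ i ∈ s, ContinuousOn (f i) (polycircle R)) :
    torusIntegral (fun w => ∑ i ∈ s, f i w) 0 R = ∑ i ∈ s, torusIntegral (f i) 0 R := by
  classical
  induction s using Finset.induction_on with
  | empty => simp [torusIntegral]
  | insert i s hi ih =>
    have h1 : ContinuousOn (fun w => ∑ i ∈ s, f i w) (polycircle R) :=
      continuousOn_finsetSum s fun k hk => hf k (Finset.mem_insert_of_mem hk)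
    simp only [Finset.sum_insert hi]
    rw [← ih fun k hk => hf k (Finset.mem_insert_of_mem hk)]
    exact torusIntegral_add
      (torusIntegrable_of_continuousOn hR (hf i (Finset.mem_insert_self _ _)))
      (torusIntegrable_of_continuousOn hR h1)

end Contours

section Bethe

lemma differentiableAt_finsetProd {E ι : Type*} [NormedAddCommGroup E] [NormedSpace ℂ E]
    {s : Finset ι} {f : ι → E → ℂ} {x : E} (hf : ∀ i ∈ s, DifferentiableAt ℂ (f i) x) :
    DifferentiableAt ℂ (fun y => ∏ i ∈ s, f i y) x := by
  classical
  exact (HasFDerivAt.finsetProd fun i hi => (hf i hi).hasFDerivAt).differentiableAt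

variable {n : ℕ} {q : ℝ} {b : ℤ → ℝ} {Y X : Fin n → ℤ} {σ : Equiv.Perm (Fin n)}
  {w : Fin n → ℂ} {R : ℝ}

lemma differentiableAt_Acoef
    (hw : ∀ α β, α < β → σ⁻¹ β < σ⁻¹ α → (q : ℂ) * w α ≠ w β) :
    DifferentiableAt ℂ (Acoef q σ) w := by
  unfold Acoef
  refine differentiableAt_finsetProd fun p hp => ?_
  simp only [Finset.mem_filter, Finset.mem_univ, true_and] at hp
  simp only [div_eq_mul_inv]
  exact DifferentiableAt.mul (by fun_prop)
    (DifferentiableAt.inv (by fun_prop) (sub_ne_zero.2 (hw _ _ hp.1 hp.2)))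

lemma differentiableAt_betheIntegrand
    (hw : ∀ α β, α < β → σ⁻¹ β < σ⁻¹ α → (q : ℂ) * w α ≠ w β)
    (hwb : ∀ j k, Y (σ j) ≤ k → k ≤ X j → w (σ j) ≠ b k) :
    DifferentiableAt ℂ (betheIntegrand q b Y X σ) w := by
  unfold betheIntegrand
  refine (differentiableAt_Acoef hw).mul (differentiableAt_finsetProd fun j _ => ?_)
  exact (differentiableAt_siteFactor (hwb j)).comp w (f := fun w : Fin n → ℂ => w (σ j))
    (by fun_prop)

lemma validR_lt (hR : ValidR b X Y R) (i j : Fin n) {k : ℤ} (hk : Y i ≤ k) (hk' : k ≤ X j) :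
    b k < R :=
  hR k ⟨i, by have := min_le_right (X i) (Y i); lia⟩ ⟨j, hk'.trans (le_max_left _ _)⟩

lemma validR_lt_apply (hR : ValidR b X Y R) (j : Fin n) : b (X j) < R :=
  hR _ ⟨j, by have := min_le_left (X j) (Y j); lia⟩ ⟨j, le_max_left _ _⟩

lemma validR_mono {R' : ℝ} (hR : ValidR b X Y R) (h : R ≤ R') : ValidR b X Y R' :=
  fun k hk hk' => (hR k hk hk').trans_le h

lemma ofReal_ne_of_lt_norm {z : ℂ} {x : ℝ} (hx : 0 < x) (h : x < ‖z‖) : z ≠ x := by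
  rintro rfl
  rw [norm_real, Real.norm_of_nonneg hx.le] at h
  exact h.false

lemma mul_ne_of_norm_le (hq : q ∈ Set.Ioo (0 : ℝ) 1) {z u : ℂ} (hz : ‖z‖ ≤ ‖u‖)
    (hu : 0 < ‖u‖) : (q : ℂ) * z ≠ u := by
  rintro rfl
  rw [norm_mul, norm_real, Real.norm_of_nonneg hq.1.le] at hz hu
  have h1 := pos_of_mul_pos_right hu hq.1.le
  nlinarith [hq.2]

lemma differentiableAt_betheIntegrand_of_monotone (hq : q ∈ Set.Ioo (0 : ℝ) 1)
    (hb : ∀ i, 0 < b i) (hR0 : 0 < R) (hR : ValidR b X Y R) (hmono : Monotone fun j => ‖w j‖)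
    (hle : ∀ j, R ≤ ‖w j‖) : DifferentiableAt ℂ (betheIntegrand q b Y X σ) w :=
  differentiableAt_betheIntegrand
    (fun _ β hαβ _ => mul_ne_of_norm_le hq (hmono hαβ.le) (hR0.trans_le (hle β)))
    fun j k hk hk' => ofReal_ne_of_lt_norm (hb k) ((validR_lt hR _ j hk hk').trans_le (hle _))

lemma continuousOn_betheIntegrand (hq : q ∈ Set.Ioo (0 : ℝ) 1) (hb : ∀ i, 0 < b i)
    (hR0 : 0 < R) (hR : ValidR b X Y R) :
    ContinuousOn (betheIntegrand q b Y X σ) (polycircle fun _ => R) := fun w hw =>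
  (differentiableAt_betheIntegrand_of_monotone hq hb hR0 hR
    (fun i j _ => by simp only [hw i, hw j, le_refl]) fun j => (hw j).ge).continuousAt.continuousWithinAt

lemma continuousOn_betheSum (hq : q ∈ Set.Ioo (0 : ℝ) 1) (hb : ∀ i, 0 < b i)
    (hR0 : 0 < R) (hR : ValidR b X Y R) :
    ContinuousOn (betheSum q b Y X) (polycircle fun _ => R) :=
  continuousOn_finsetSum _ fun _ _ =>
    continuousOn_const.mul (continuousOn_betheIntegrand hq hb hR0 hR)

/-- `Lam` as a torus integral. -/
lemma Lam_eq_torusIntegral (hq : q ∈ Set.Ioo (0 : ℝ) 1) (hb : ∀ i, 0 < b i)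
    (hR0 : 0 < R) (hR : ValidR b X Y R) (t : ℝ) :
    Lam q b Y X t σ R = (1 / (2 * Real.pi * I)) ^ n * (sitePrefactor b X *
      torusIntegral (fun w => betheIntegrand q b Y X σ w * exp (-(∑ j, w j) * t)) 0
        fun _ => R) := by
  have hint : (fun w : Fin n → ℂ => Acoef q σ w *
        ∏ j, (eprod (fun k => (b k : ℂ) / ((b k : ℂ) - w (σ j))) (Y (σ j)) (X j) *
          exp (-(w j) * (t : ℂ)))) =
      fun w => betheIntegrand q b Y X σ w * exp (-(∑ j, w j) * t) := by
    ext w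
    rw [Finset.prod_mul_distrib, ← exp_sum, ← Finset.sum_mul, Finset.sum_neg_distrib, ← mul_assoc]
    rfl
  rw [Lam, hint, mcInt_eq_torusIntegral hR0.le, sitePrefactor]
  · ring
  · exact (continuousOn_betheIntegrand hq hb hR0 hR).mul (by fun_prop)

lemma sum_Lam_eq_torusIntegral (hq : q ∈ Set.Ioo (0 : ℝ) 1) (hb : ∀ i, 0 < b i)
    (hR0 : 0 < R) (hR : ValidR b X Y R) {R' : ℝ} (hRR' : R ≤ R') (t : ℝ) :
    ∑ σ : Equiv.Perm (Fin n), Lam q b Y X t σ R = (1 / (2 * Real.pi * I)) ^ n *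
      torusIntegral (fun w => betheSum q b Y X w * exp (-(∑ j, w j) * t)) 0 fun _ => R' := by
  have hR0' := hR0.trans_le hRR'
  have hR' := validR_mono hR hRR'
  have hexp : Differentiable ℂ fun w : Fin n → ℂ => exp (-(∑ j, w j) * t) := by fun_prop
  simp only [betheSum, Finset.sum_mul, mul_assoc]
  rw [torusIntegral_finset_sum _ fun _ => hR0'.le, Finset.mul_sum]
  · refine Finset.sum_congr rfl fun σ _ => ?_
    rw [Lam_eq_torusIntegral hq hb hR0 hR, torusIntegral_const_mul]
    rw [torusIntegral_eq_of_radius_le hR0 hRR', mul_assoc 2]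
    intro w hw hw'
    exact (differentiableAt_betheIntegrand_of_monotone hq hb hR0 hR hw hw').mul (hexp w)
  · exact fun σ _ => continuousOn_const.mul
      ((continuousOn_betheIntegrand hq hb hR0' hR').mul hexp.continuous.continuousOn)

end Bethe

section Master

variable {n : ℕ} {q : ℝ} {a b : ℤ → ℝ} {Y : Fin n → ℤ}

lemma hasDerivAt_sum_Lam (hq : q ∈ Set.Ioo (0 : ℝ) 1) (hb : ∀ i, 0 < b i)
    (hab : ∀ i, b i = a i * (1 - q)) {Rsel : (Fin n → ℤ) → ℝ} (hR0 : ∀ X, 0 < Rsel X)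
    (hRsel : ∀ X, ValidR b X Y (Rsel X)) {X : Fin n → ℤ} (hX : Antitone X) (t : ℝ) :
    HasDerivAt (fun t => ∑ σ : Equiv.Perm (Fin n), Lam q b Y X t σ (Rsel X))
      (∑ s ∈ Finset.univ.image X, (1 - (q : ℂ) ^ cnt X s) *
        ((a (s - 1) : ℂ) * (∑ σ : Equiv.Perm (Fin n),
            Lam q b Y (lowerLast X s) t σ (Rsel (lowerLast X s))) -
          (a s : ℂ) * ∑ σ : Equiv.Perm (Fin n), Lam q b Y X t σ (Rsel X))) t := by
  set R := Rsel X + ∑ s ∈ Finset.univ.image X, Rsel (lowerLast X s)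
  have hRX : Rsel X ≤ R :=
    le_add_of_nonneg_right (Finset.sum_nonneg fun s _ => (hR0 _).le)
  have hRl : ∀ s ∈ Finset.univ.image X, Rsel (lowerLast X s) ≤ R := fun s hs =>
    (Finset.single_le_sum (f := fun s => Rsel (lowerLast X s)) (fun s _ => (hR0 _).le) hs).trans
      (le_add_of_nonneg_left (hR0 X).le)
  have hRpos : 0 < R := (hR0 X).trans_le hRX
  have hRX' := validR_mono (hRsel X) hRX
  rw [funext fun t => sum_Lam_eq_torusIntegral hq hb (hR0 X) (hRsel X) hRX t]
  rw [Finset.sum_congr rfl fun s hs => by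
    rw [sum_Lam_eq_torusIntegral hq hb (hR0 X) (hRsel X) hRX t,
      sum_Lam_eq_torusIntegral hq hb (hR0 _) (hRsel _) (hRl s hs) t]]
  have hexp : ContinuousOn (fun w : Fin n → ℂ => exp (-(∑ j, w j) * t))
    (polycircle fun _ => R) := by fun_prop
  have hc := continuousOn_betheSum hq hb hRpos hRX'
  have hcl : ∀ s ∈ Finset.univ.image X,
      ContinuousOn (betheSum q b Y (lowerLast X s)) (polycircle fun _ => R) := fun s hs =>
    continuousOn_betheSum hq hb hRpos (validR_mono (hRsel _) (hRl s hs))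
  refine ((hasDerivAt_torusIntegral_mul_exp (fun _ => hRpos.le) hc
    (h := fun w => -(∑ j, w j)) (by fun_prop) t).const_mul
      ((1 / (2 * Real.pi * I)) ^ n)).congr_deriv ?_
  rw [torusIntegral_congr (fun _ => hRpos.le) (g := fun w => ∑ s ∈ Finset.univ.image X,
    (1 - (q : ℂ) ^ cnt X s) * ((a (s - 1) : ℂ) *
        (betheSum q b Y (lowerLast X s) w * exp (-(∑ j, w j) * t)) -
          (a s : ℂ) * (betheSum q b Y X w * exp (-(∑ j, w j) * t)))) fun w hw => ?_]
  · rw [torusIntegral_finset_sum _ (fun _ => hRpos.le), Finset.mul_sum]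
    · refine Finset.sum_congr rfl fun s hs => ?_
      rw [torusIntegral_const_mul, torusIntegral_sub, torusIntegral_const_mul,
        torusIntegral_const_mul]
      · ring
      · exact torusIntegrable_of_continuousOn (fun _ => hRpos.le)
          (continuousOn_const.mul ((hcl s hs).mul hexp))
      · exact torusIntegrable_of_continuousOn (fun _ => hRpos.le)
          (continuousOn_const.mul (hc.mul hexp))
    · exact fun s hs => continuousOn_const.mul ((continuousOn_const.mul ((hcl s hs).mul hexp)).sub
        (continuousOn_const.mul (hc.mul hexp)))
  · have hne : ∀ α β, α < β → (q : ℂ) * w α ≠ w β := fun α β _ =>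
      mul_ne_of_norm_le hq (by rw [hw, hw]) (by rw [hw]; exact hRpos)
    have hneX : ∀ i j, w i ≠ b (X j) := fun i j =>
      ofReal_ne_of_lt_norm (hb _) (by rw [hw]; exact validR_lt_apply hRX' j)
    rw [← mul_assoc, neg_sum_mul_betheSum hq.2 hb hab hX hne hneX, Finset.sum_mul]
    refine Finset.sum_congr rfl fun s _ => ?_
    ring

lemma inv_Wcoef_mul (hq : q ∈ Set.Ioo (0 : ℝ) 1) {X : Fin n → ℤ} {s : ℤ}
    (hs : s ∈ Finset.univ.image X) :
    ((Wcoef q X : ℝ) : ℂ)⁻¹ * (1 - (q : ℂ) ^ cnt X s) =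
      (1 - (q : ℂ) ^ cnt (lowerLast X s) (s - 1)) * ((Wcoef q (lowerLast X s) : ℝ) : ℂ)⁻¹ := by
  obtain ⟨l, rfl, hlast⟩ := exists_last X hs
  rw [lowerLast_eq_update rfl hlast]
  have h1 : ((Wcoef q X : ℝ) : ℂ) ≠ 0 := by exact_mod_cast (Wcoef_pos hq X).ne'
  have h2 : ((Wcoef q (update X l (X l - 1)) : ℝ) : ℂ) ≠ 0 := by
    exact_mod_cast (Wcoef_pos hq _).ne'
  have h3 : ((Wcoef q (update X l (X l - 1)) : ℝ) : ℂ) * (1 - (q : ℂ) ^ cnt X (X l)) =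
      (Wcoef q X : ℝ) * (1 - (q : ℂ) ^ cnt (update X l (X l - 1)) (X l - 1)) := by
    exact_mod_cast Wcoef_update_pred q X l
  field_simp
  linear_combination h3

lemma masterEq_inv_Wcoef_mul_sum_Lam (hq : q ∈ Set.Ioo (0 : ℝ) 1) (hb : ∀ i, 0 < b i)
    (hab : ∀ i, b i = a i * (1 - q)) {Rsel : (Fin n → ℤ) → ℝ} (hR0 : ∀ X, 0 < Rsel X)
    (hRsel : ∀ X, ValidR b X Y (Rsel X)) :
    MasterEq q a (fun X t => ((Wcoef q X : ℝ) : ℂ)⁻¹ *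
      ∑ σ : Equiv.Perm (Fin n), Lam q b Y X t σ (Rsel X)) := by
  intro X hX t _
  refine ((hasDerivAt_sum_Lam hq hb hab hR0 hRsel hX t).const_mul
    ((Wcoef q X : ℝ) : ℂ)⁻¹).congr_deriv ?_
  rw [← Finset.sum_sub_distrib, Finset.mul_sum]
  refine Finset.sum_congr rfl fun s hs => ?_
  have := inv_Wcoef_mul hq hs
  dsimp only
  generalize ∑ σ : Equiv.Perm (Fin n), Lam q b Y X t σ (Rsel X) = L₁,
    ∑ σ : Equiv.Perm (Fin n), Lam q b Y (lowerLast X s) t σ (Rsel (lowerLast X s)) = L₂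
  linear_combination ((a (s - 1) : ℂ) * L₂) * this

end Master

section Inversions

variable {n : ℕ}

/-- The number of inversions of `σ⁻¹`. -/
def invCount (σ : Equiv.Perm (Fin n)) : ℕ :=
  (Finset.univ.filter (fun p : Fin n × Fin n => p.2 < p.1 ∧ σ p.1 < σ p.2)).card

lemma invCount_eq_sum (σ : Equiv.Perm (Fin n)) :
    invCount σ = ∑ i, ∑ k, if k < i ∧ σ i < σ k then 1 else 0 := by
  rw [invCount, Finset.card_filter, Fintype.sum_prod_type]

/-- The permutation with first value `j` and remaining values ordered as in `τ`. -/
def consPerm (j : Fin (n + 1)) (τ : Equiv.Perm (Fin n)) : Equiv.Perm (Fin (n + 1)) :=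
  j.cycleRange.symm * Equiv.Perm.decomposeFin.symm (0, τ)

@[simp]
lemma consPerm_zero (j : Fin (n + 1)) (τ : Equiv.Perm (Fin n)) : consPerm j τ 0 = j := by
  simp [consPerm]

@[simp]
lemma consPerm_succ (j : Fin (n + 1)) (τ : Equiv.Perm (Fin n)) (i : Fin n) :
    consPerm j τ i.succ = j.succAbove (τ i) := by
  simp [consPerm]

lemma bijective_consPerm :
    Bijective fun p : Fin (n + 1) × Equiv.Perm (Fin n) => consPerm p.1 p.2 := by
  refine (Fintype.bijective_iff_injective_and_card _).2 ⟨?_, ?_⟩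
  · rintro ⟨j, τ⟩ ⟨j', τ'⟩ h
    simp only at h
    obtain rfl : j = j' := by simpa using DFunLike.congr_fun h 0
    refine Prod.ext rfl (Equiv.ext fun i => ?_)
    simpa using DFunLike.congr_fun h i.succ
  · simp [Fintype.card_perm, Nat.factorial_succ]

lemma invCount_consPerm (j : Fin (n + 1)) (τ : Equiv.Perm (Fin n)) :
    invCount (consPerm j τ) = j + invCount τ := by
  rw [invCount_eq_sum, invCount_eq_sum, Fin.sum_univ_succ]
  simp only [Fin.sum_univ_succ, consPerm_zero, consPerm_succ, Fin.not_lt_zero, false_and,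
    if_false, Finset.sum_const_zero, zero_add, Fin.succ_pos, true_and, Fin.succ_lt_succ_iff,
    Fin.succAbove_lt_succAbove_iff, Finset.sum_add_distrib]
  congr 1
  rw [Equiv.sum_comp τ fun i => if j.succAbove i < j then 1 else 0, ← Finset.card_filter]
  simp only [Fin.succAbove_lt_iff_castSucc_lt]
  simp only [Fin.lt_def, Fin.val_castSucc]
  rw [Fin.card_filter_val_lt]
  lia

lemma sum_fiber_zero_pow {q : ℝ} (hq : q ≠ 1) {Y : Fin (n + 1) → ℤ} (hY : Antitone Y) :
    ∑ j, (if Y j = Y 0 then q ^ j.val else 0) = (1 - q ^ cnt Y (Y 0)) / (1 - q) := by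
  obtain ⟨l, hl, hlast⟩ := exists_last Y (Finset.mem_image_of_mem Y (Finset.mem_univ 0))
  have hset : Finset.univ.filter (fun j => Y j = Y 0) = Finset.Iic l := by
    ext j
    simp only [Finset.mem_filter, Finset.mem_univ, true_and, Finset.mem_Iic]
    refine ⟨fun h => not_lt.1 fun hlj => hlast j hlj h, fun h => ?_⟩
    have h1 := hY h
    have h2 := hY (Fin.zero_le j)
    lia
  have hmap := Finset.sum_map (Finset.Iic l) Fin.valEmbedding (fun i => q ^ i)
  simp only [Fin.valEmbedding_apply] at hmap
  rw [← Finset.sum_filter, cnt, hset, Fin.card_Iic, ← hmap, Fin.map_valEmbedding_Iic,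
    ← Nat.range_succ_eq_Iic, eq_div_iff (sub_ne_zero.2 hq.symm), geom_sum_mul_neg]

lemma Wcoef_succ (q : ℝ) (Y : Fin (n + 1) → ℤ) :
    Wcoef q Y = (1 - q ^ cnt Y (Y 0)) / (1 - q) * Wcoef q (fun i : Fin n => Y i.succ) := by
  set Y' := fun i : Fin n => Y i.succ with hY'
  have hc : ∀ s, cnt Y s = (if Y 0 = s then 1 else 0) + cnt Y' s := fun s => by
    rw [cnt_eq_sum, cnt_eq_sum, Fin.sum_univ_succ]
  have hT : Finset.univ.image Y' ⊆ Finset.univ.image Y := by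
    intro s
    simp only [Finset.mem_image, Finset.mem_univ, true_and, hY']
    rintro ⟨i, rfl⟩
    exact ⟨_, rfl⟩
  have h0 : Y 0 ∈ Finset.univ.image Y := Finset.mem_image_of_mem Y (Finset.mem_univ 0)
  rw [Wcoef_eq_prod_of_subset hT, Wcoef, ← Finset.mul_prod_erase _ _ h0,
    ← Finset.mul_prod_erase _ _ h0,
    Finset.prod_congr rfl fun s hs => by
      rw [hc s, if_neg (Finset.ne_of_mem_erase hs).symm, zero_add], hc (Y 0), if_pos rfl,
    add_comm 1, qfac_succ]
  ring

lemma comp_succAbove_eq_of_antitone {Y : Fin (n + 1) → ℤ} (hY : Antitone Y) {j : Fin (n + 1)}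
    (hj : Y j = Y 0) (i : Fin n) : Y (j.succAbove i) = Y i.succ := by
  rcases lt_or_ge i.castSucc j with h | h
  · rw [Fin.succAbove_of_castSucc_lt _ _ h]
    have h1 := hY (Fin.zero_le i.castSucc)
    have h2 : Y j ≤ Y i.succ := hY (by simpa [Fin.le_def, Fin.lt_def] using h)
    have h3 := hY (Fin.zero_le i.succ)
    have h4 : Y i.succ ≤ Y i.castSucc := hY (by simp [Fin.le_def])
    lia
  · rw [Fin.succAbove_of_le_castSucc _ _ h]

/-- The generating function of inversions over the stabilizer of `Y`. -/
lemma sum_stabilizer_pow_invCount {q : ℝ} (hq : q ≠ 1) : ∀ {n : ℕ} {Y : Fin n → ℤ},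
    Antitone Y → ∑ σ : Equiv.Perm (Fin n), (if ∀ j, Y (σ j) = Y j then q ^ invCount σ else 0) =
      Wcoef q Y
  | 0, Y, _ => by
    simp [Wcoef, invCount]
  | n + 1, Y, hY => by
    have hY' : Antitone fun i : Fin n => Y i.succ := fun i j hij =>
      hY (Fin.succ_le_succ_iff.2 hij)
    rw [← bijective_consPerm.sum_comp, Fintype.sum_prod_type, Wcoef_succ,
      ← sum_fiber_zero_pow hq hY, ← sum_stabilizer_pow_invCount hq hY', Finset.sum_mul]
    refine Finset.sum_congr rfl fun j _ => ?_
    rw [Finset.mul_sum]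
    refine Finset.sum_congr rfl fun τ _ => ?_
    simp only [Fin.forall_fin_succ, consPerm_zero, consPerm_succ, invCount_consPerm]
    by_cases hj : Y j = Y 0
    · simp only [hj, true_and, comp_succAbove_eq_of_antitone hY hj, if_true, mul_ite, mul_zero,
        pow_add]
    · simp [hj]

end Inversions

section Initial

variable {n : ℕ} {q : ℝ} {b : ℤ → ℝ} {Y X : Fin n → ℤ} {σ : Equiv.Perm (Fin n)} {R : ℝ}

/-- The index set of the product defining `Acoef`. -/
def inversions (σ : Equiv.Perm (Fin n)) : Finset (Fin n × Fin n) :=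
  Finset.univ.filter fun p => p.2 < p.1 ∧ σ⁻¹ p.1 < σ⁻¹ p.2

lemma mem_inversions {p : Fin n × Fin n} :
    p ∈ inversions σ ↔ p.2 < p.1 ∧ σ⁻¹ p.1 < σ⁻¹ p.2 := by
  simp [inversions]

/-- The scattering factor `S_{(β,α)}` with `p = (β,α)`. -/
noncomputable def scattering (q : ℝ) (p : Fin n × Fin n) (w : Fin n → ℂ) : ℂ :=
  -((q : ℂ) * w p.1 - w p.2) / ((q : ℂ) * w p.2 - w p.1)

lemma Acoef_eq_prod_scattering (w : Fin n → ℂ) :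
    Acoef q σ w = ∏ p ∈ inversions σ, scattering q p w := rfl

lemma tendsto_scattering_update (y : Fin n → ℂ) {α : Fin n} {p : Fin n × Fin n}
    (hp : p.2 ≠ α) :
    Tendsto (fun z => scattering q p (update y α z)) (Bornology.cobounded ℂ)
      (𝓝 (if p.1 = α then (q : ℂ) else scattering q p y)) := by
  simp only [scattering, update_of_ne hp]
  split_ifs with h
  · simp only [h, update_self]
    exact tendsto_scattering_cobounded _ _
  · simp only [update_of_ne h]
    exact tendsto_const_nhds

lemma differentiableAt_update (y : Fin n → ℂ) (α : Fin n) (z : ℂ) :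
    DifferentiableAt ℂ (update y α) z :=
  (hasDerivAt_update y α z).differentiableAt

/-- If some particle would have to move backwards the contribution of `σ` vanishes. -/
lemma torusIntegral_betheIntegrand_eq_zero_of_lt (hq : q ∈ Set.Ioo (0 : ℝ) 1)
    (hb : ∀ i, 0 < b i) (hR0 : 0 < R) (hR : ValidR b X Y R) (hX : Antitone X) (hY : Antitone Y)
    (h : ∃ α, X (σ⁻¹ α) < Y α) :
    torusIntegral (betheIntegrand q b Y X σ) 0 (fun _ => R) = 0 := by
  obtain ⟨α, hα, hmin⟩ : ∃ α, X (σ⁻¹ α) < Y α ∧ ∀ γ, γ < α → Y γ ≤ X (σ⁻¹ γ) := by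
    have hne : (Finset.univ.filter fun α => X (σ⁻¹ α) < Y α).Nonempty := by
      obtain ⟨α, hα⟩ := h
      exact ⟨α, by simpa using hα⟩
    refine ⟨_, by simpa using Finset.min'_mem _ hne, fun γ hγ => not_lt.1 fun hlt => ?_⟩
    exact hγ.not_ge (Finset.min'_le _ _ (by simpa using hlt))
  refine torusIntegral_eq_zero_of_circleIntegral (fun _ => hR0.le)
    (continuousOn_betheIntegrand hq hb hR0 hR) α fun y hy => ?_
  refine circleIntegral_eq_zero_of_differentiableAt hR0.le fun z hz => ?_
  refine (differentiableAt_betheIntegrand (fun γ β hγβ hinv => ?_) fun j k hk hk' => ?_).comp z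
    (differentiableAt_update y α z)
  · rcases eq_or_ne β α with rfl | hβ
    · have h1 := hmin γ hγβ
      have h2 := hX hinv.le
      have h3 := hY hγβ.le
      lia
    · rw [update_of_ne hβ]
      have hyβ := hy β hβ
      refine mul_ne_of_norm_le hq ?_ (by rw [hyβ]; exact hR0)
      rw [hyβ]
      rcases eq_or_ne γ α with rfl | hγ
      · rwa [update_self]
      · rw [update_of_ne hγ, hy γ hγ]
  · rcases eq_or_ne (σ j) α with hj | hj
    · rw [← hj, Equiv.Perm.coe_inv, Equiv.symm_apply_apply] at hα
      lia
    · rw [update_of_ne hj]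
      exact ofReal_ne_of_lt_norm (hb k) (by rw [hy _ hj]; exact validR_lt hR _ j hk hk')

/-- If some particle would have to move forwards in no time the contribution of `σ` vanishes. -/
lemma torusIntegral_betheIntegrand_eq_zero_of_gt (hq : q ∈ Set.Ioo (0 : ℝ) 1)
    (hb : ∀ i, 0 < b i) (hR0 : 0 < R) (hR : ValidR b X Y R) (hX : Antitone X) (hY : Antitone Y)
    (h : ∃ α, Y α < X (σ⁻¹ α)) :
    torusIntegral (betheIntegrand q b Y X σ) 0 (fun _ => R) = 0 := by
  obtain ⟨α, hα, hmax⟩ : ∃ α, Y α < X (σ⁻¹ α) ∧ ∀ β, α < β → X (σ⁻¹ β) ≤ Y β := by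
    have hne : (Finset.univ.filter fun α => Y α < X (σ⁻¹ α)).Nonempty := by
      obtain ⟨α, hα⟩ := h
      exact ⟨α, by simpa using hα⟩
    refine ⟨_, by simpa using Finset.max'_mem _ hne, fun β hβ => not_lt.1 fun hlt => ?_⟩
    exact hβ.not_ge (Finset.le_max' _ _ (by simpa using hlt))
  have hnot : ∀ β, α < β → ¬ σ⁻¹ β < σ⁻¹ α := fun β hβ hinv => by
    have h1 := hmax β hβ
    have h2 := hX hinv.le
    have h3 := hY hβ.le
    lia
  refine torusIntegral_eq_zero_of_circleIntegral (fun _ => hR0.le)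
    (continuousOn_betheIntegrand hq hb hR0 hR) α fun y hy => ?_
  rw [circleIntegral_eq_of_tendsto_cobounded hR0 (l := 0), mul_zero]
  · intro z hz
    have hnorm : ∀ j, R ≤ ‖update y α z j‖ := fun j => by
      rcases eq_or_ne j α with rfl | hj
      · rwa [update_self]
      · rw [update_of_ne hj, hy j hj]
    refine (differentiableAt_betheIntegrand (fun γ β hγβ hinv => ?_) fun j k hk hk' => ?_).comp z
      (differentiableAt_update y α z)
    · have hγ : γ ≠ α := by
        rintro rfl
        exact hnot β hγβ hinv
      refine mul_ne_of_norm_le hq ?_ (hR0.trans_le (hnorm β))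
      rw [update_of_ne hγ, hy γ hγ]
      exact hnorm β
    · exact ofReal_ne_of_lt_norm (hb k) ((validR_lt hR _ j hk hk').trans_le (hnorm _))
  · have hA : Tendsto (fun z => Acoef q σ (update y α z)) (Bornology.cobounded ℂ)
        (𝓝 (∏ p ∈ inversions σ, if p.1 = α then (q : ℂ) else scattering q p y)) := by
      simp only [Acoef_eq_prod_scattering]
      refine tendsto_finsetProd _ fun p hp => tendsto_scattering_update y ?_
      rintro rfl
      rw [mem_inversions] at hp
      exact hnot _ hp.1 hp.2
    have hS := (tendsto_mul_siteFactor (b := b) hα).const_mul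
      (∏ j ∈ Finset.univ.erase (σ⁻¹ α), siteFactor b (Y (σ j)) (X j) (y (σ j)))
    have hprod := hA.mul hS
    rw [mul_zero, mul_zero] at hprod
    refine hprod.congr fun z => ?_
    have hσα : σ (σ⁻¹ α) = α := by simp
    have hrest : ∏ j ∈ Finset.univ.erase (σ⁻¹ α), siteFactor b (Y (σ j)) (X j)
          (update y α z (σ j)) =
        ∏ j ∈ Finset.univ.erase (σ⁻¹ α), siteFactor b (Y (σ j)) (X j) (y (σ j)) :=
      Finset.prod_congr rfl fun j hj => by
        rw [update_of_ne fun h : σ j = α => Finset.ne_of_mem_erase hj (by simp [← h])]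
    rw [betheIntegrand, ← Finset.mul_prod_erase _ _ (Finset.mem_univ (σ⁻¹ α)), hrest, hσα,
      update_self]
    ring

lemma eq_of_comp_eq (hX : Antitone X) (hY : Antitone Y) (h : ∀ j, X j = Y (σ j)) : X = Y := by
  have hX' : X = Y ∘ σ := funext h
  have := Tuple.unique_antitone (f := Y) (σ := σ) (τ := 1) (hX' ▸ hX) (by simpa using hY)
  rw [hX', this]
  rfl

lemma torusIntegral_betheIntegrand_eq_zero (hq : q ∈ Set.Ioo (0 : ℝ) 1)
    (hb : ∀ i, 0 < b i) (hR0 : 0 < R) (hR : ValidR b X Y R) (hX : Antitone X) (hY : Antitone Y)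
    (h : ¬ ∀ j, X j = Y (σ j)) :
    torusIntegral (betheIntegrand q b Y X σ) 0 (fun _ => R) = 0 := by
  obtain ⟨j, hj⟩ := not_forall.1 h
  rcases lt_or_gt_of_ne hj with hlt | hlt
  · exact torusIntegral_betheIntegrand_eq_zero_of_lt hq hb hR0 hR hX hY ⟨σ j, by simpa using hlt⟩
  · exact torusIntegral_betheIntegrand_eq_zero_of_gt hq hb hR0 hR hX hY ⟨σ j, by simpa using hlt⟩

/-- Interpolates between the diagonal Bethe integrand (`m = n`) and the product of the `w_j⁻¹`
(`m = 0`). -/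
noncomputable def residueStep (q : ℝ) (c : Fin n → ℂ) (I : Finset (Fin n × Fin n)) (m : ℕ)
    (w : Fin n → ℂ) : ℂ :=
  (∏ p ∈ I, if m ≤ p.1.val then (q : ℂ) else scattering q p w) *
    ∏ j, (w j - if m ≤ j.val then 0 else c j)⁻¹

lemma differentiableAt_residueStep {c : Fin n → ℂ} {I : Finset (Fin n × Fin n)} {m : ℕ}
    {w : Fin n → ℂ}
    (hI : ∀ p ∈ I, p.1.val < m → (q : ℂ) * w p.2 ≠ w p.1) (h0 : ∀ j, w j ≠ 0)
    (hc : ∀ j, w j ≠ c j) : DifferentiableAt ℂ (residueStep q c I m) w := by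
  unfold residueStep
  refine (differentiableAt_finsetProd fun p hp => ?_).mul (differentiableAt_finsetProd fun j _ => ?_)
  · by_cases h : m ≤ p.1.val
    · simp only [if_pos h]
      fun_prop
    · simp only [if_neg h, scattering, div_eq_mul_inv]
      exact DifferentiableAt.mul (by fun_prop)
        (DifferentiableAt.inv (by fun_prop) (sub_ne_zero.2 (hI p hp (not_le.1 h))))
  · refine DifferentiableAt.inv (by fun_prop) (sub_ne_zero.2 ?_)
    split_ifs
    exacts [h0 j, hc j]

lemma tendsto_mul_residueStep (c : Fin n → ℂ) {I : Finset (Fin n × Fin n)}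
    (hI : ∀ p ∈ I, p.2 < p.1) (i : Fin n) {m : ℕ} (hm : m = i ∨ m = i + 1) (y : Fin n → ℂ) :
    Tendsto (fun z => z * residueStep q c I m (update y i z)) (Bornology.cobounded ℂ)
      (𝓝 ((∏ p ∈ I, if i ≤ p.1 then (q : ℂ) else scattering q p y) *
        ∏ j, if j = i then 1 else (y j - if i ≤ j then 0 else c j)⁻¹)) := by
  have h1 : Tendsto (fun z => ∏ p ∈ I, if m ≤ p.1.val then (q : ℂ) else
      scattering q p (update y i z)) (Bornology.cobounded ℂ)
      (𝓝 (∏ p ∈ I, if i ≤ p.1 then (q : ℂ) else scattering q p y)) := by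
    refine tendsto_finsetProd _ fun p hp => ?_
    have hlt := hI p hp
    simp only [Fin.le_def, Fin.lt_def] at hlt ⊢
    by_cases h : m ≤ p.1.val
    · simp only [if_pos h, if_pos (show i.val ≤ p.1.val by lia)]
      exact tendsto_const_nhds
    · have hp2 : p.2 ≠ i := by
        rintro rfl
        lia
      simp only [if_neg h]
      convert tendsto_scattering_update (q := q) y hp2 using 2
      simp only [Fin.ext_iff, show (i.val ≤ p.1.val ↔ p.1.val = i.val) by lia]
  have h2 : Tendsto (fun z => ∏ j, (if j = i then z else 1) *
      (update y i z j - if m ≤ j.val then 0 else c j)⁻¹) (Bornology.cobounded ℂ)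
      (𝓝 (∏ j, if j = i then 1 else (y j - if i ≤ j then 0 else c j)⁻¹)) := by
    refine tendsto_finsetProd _ fun j _ => ?_
    rcases eq_or_ne j i with rfl | hj
    · simp only [if_true, update_self]
      exact tendsto_mul_inv_sub_cobounded _
    · have hj' : j.val ≠ i.val := fun h => hj (Fin.ext h)
      simp only [if_neg hj, update_of_ne hj, one_mul, Fin.le_def,
        show (m ≤ j.val ↔ i.val ≤ j.val) by lia]
      exact tendsto_const_nhds
  refine (h1.mul h2).congr fun z => ?_
  rw [Finset.prod_mul_distrib, Finset.prod_ite_eq' _ _ _, if_pos (Finset.mem_univ i), residueStep]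
  ring

lemma torusIntegral_prod_inv (hR : R ≠ 0) :
    torusIntegral (fun w : Fin n → ℂ => ∏ j, (w j)⁻¹) 0 (fun _ => R) =
      (2 * Real.pi * I) ^ n := by
  have hR' : (R : ℂ) ≠ 0 := by exact_mod_cast hR
  have hconst : ∀ θ : Fin n → ℝ, (∏ i, (R : ℂ) * exp (θ i * I) * I) •
      ∏ j, (torusMap 0 (fun _ => R) θ j)⁻¹ = I ^ n := by
    intro θ
    rw [smul_eq_mul, ← Finset.prod_mul_distrib]
    have : ∀ i, (R : ℂ) * exp (θ i * I) * I * (torusMap 0 (fun _ => R) θ i)⁻¹ = I := by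
      intro i
      have h := exp_ne_zero (θ i * I)
      simp only [torusMap, Pi.zero_apply, zero_add]
      field_simp
    simp [this]
  unfold torusIntegral
  simp only [hconst]
  rw [setIntegral_const, measureReal_def, Pi.zero_def,
    Real.volume_Icc_pi_toReal fun _ => Real.two_pi_pos.le]
  simp [mul_pow]

lemma torusIntegral_residueStep (hq : q ∈ Set.Ioo (0 : ℝ) 1) (hR0 : 0 < R) {c : Fin n → ℂ}
    (hc : ∀ j, ‖c j‖ < R) {I : Finset (Fin n × Fin n)} (hI : ∀ p ∈ I, p.2 < p.1) :
    torusIntegral (residueStep q c I n) 0 (fun _ => R) =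
      (q : ℂ) ^ I.card * (2 * Real.pi * Complex.I) ^ n := by
  have hdiff : ∀ (m : ℕ) (w : Fin n → ℂ), (∀ j, R ≤ ‖w j‖) →
      (∀ p ∈ I, p.1.val < m → ‖w p.2‖ ≤ ‖w p.1‖) →
      DifferentiableAt ℂ (residueStep q c I m) w := by
    intro m w hw hp
    refine differentiableAt_residueStep
      (fun p hpI hpm => mul_ne_of_norm_le hq (hp p hpI hpm) (hR0.trans_le (hw _)))
      (fun j => norm_pos_iff.1 (hR0.trans_le (hw j))) fun j h => ?_
    exact (hc j).not_ge (h ▸ hw j)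
  have hcont : ∀ m, ContinuousOn (residueStep q c I m) (polycircle fun _ => R) := fun m w hw =>
    (hdiff m w (fun j => (hw j).ge) fun p _ _ => by
      rw [hw, hw]).continuousAt.continuousWithinAt
  have hstep : ∀ m, m < n → torusIntegral (residueStep q c I m) 0 (fun _ => R) =
      torusIntegral (residueStep q c I (m + 1)) 0 (fun _ => R) := by
    intro m hm
    refine torusIntegral_congr_of_circleIntegral (fun _ => hR0.le) (fun _ => hR0.le)
      (hcont _) (hcont _) ⟨m, hm⟩ (fun _ _ => rfl) fun y hy => ?_
    have hd : ∀ k, k ≤ m + 1 → ∀ z : ℂ, R ≤ ‖z‖ →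
        DifferentiableAt ℂ (fun z => residueStep q c I k (update y ⟨m, hm⟩ z)) z := by
      intro k hk z hz
      have hnorm : ∀ j, R ≤ ‖update y ⟨m, hm⟩ z j‖ := fun j => by
        rcases eq_or_ne j ⟨m, hm⟩ with rfl | hj
        · rwa [update_self]
        · rw [update_of_ne hj, hy j hj]
      refine (hdiff k _ hnorm fun p hpI hpk => ?_).comp z (differentiableAt_update y _ z)
      have hlt := hI p hpI
      have hp2 : p.2 ≠ ⟨m, hm⟩ := by
        simp only [ne_eq, Fin.ext_iff, Fin.lt_def] at hlt ⊢
        lia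
      rw [update_of_ne hp2, hy _ hp2]
      exact hnorm _
    rw [circleIntegral_eq_of_tendsto_cobounded hR0 (hd m (by lia))
        (tendsto_mul_residueStep c hI ⟨m, hm⟩ (Or.inl rfl) y),
      circleIntegral_eq_of_tendsto_cobounded hR0 (hd (m + 1) le_rfl)
        (tendsto_mul_residueStep c hI ⟨m, hm⟩ (Or.inr rfl) y)]
  have hall : ∀ m, m ≤ n → torusIntegral (residueStep q c I 0) 0 (fun _ => R) =
      torusIntegral (residueStep q c I m) 0 (fun _ => R) := by
    intro m
    induction m with
    | zero => exact fun _ => rfl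
    | succ m ih => exact fun hm => (ih (by lia)).trans (hstep m hm)
  have h0 : residueStep q c I 0 = fun w => (q : ℂ) ^ I.card * ∏ j, (w j)⁻¹ := by
    ext w
    simp [residueStep]
  rw [← hall n le_rfl, h0, torusIntegral_const_mul, torusIntegral_prod_inv hR0.ne']

lemma betheIntegrand_self (hσ : ∀ j, Y (σ j) = Y j) (w : Fin n → ℂ) :
    betheIntegrand q b Y Y σ w = (∏ j, -(b (Y j) : ℂ)) *
      residueStep q (fun j => b (Y j)) (inversions σ) n w := by
  have h1 : ∀ j : Fin n, ¬ n ≤ j.val := fun j => not_le.2 j.2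
  have h2 : ∏ j, siteFactor b (Y (σ j)) (Y j) (w (σ j)) = ∏ j, siteFactor b (Y j) (Y j) (w j) := by
    rw [← Equiv.prod_comp σ fun j => siteFactor b (Y j) (Y j) (w j)]
    exact Finset.prod_congr rfl fun j _ => by rw [hσ]
  simp only [residueStep, h1, if_false]
  rw [betheIntegrand, Acoef_eq_prod_scattering, h2, mul_left_comm, ← Finset.prod_mul_distrib]
  congr 1
  refine Finset.prod_congr rfl fun j _ => ?_
  rw [siteFactor_self, ← neg_sub (w j), div_neg, div_eq_mul_inv, neg_mul]

lemma card_inversions (σ : Equiv.Perm (Fin n)) : (inversions σ).card = invCount σ⁻¹ := rfl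

lemma Lam_zero_eq_zero (hq : q ∈ Set.Ioo (0 : ℝ) 1) (hb : ∀ i, 0 < b i) (hR0 : 0 < R)
    (hR : ValidR b X Y R) (hX : Antitone X) (hY : Antitone Y) (h : ¬ ∀ j, X j = Y (σ j)) :
    Lam q b Y X 0 σ R = 0 := by
  rw [Lam_eq_torusIntegral hq hb hR0 hR]
  simp only [ofReal_zero, mul_zero, exp_zero, mul_one]
  rw [torusIntegral_betheIntegrand_eq_zero hq hb hR0 hR hX hY h, mul_zero, mul_zero]

lemma Lam_self_zero (hq : q ∈ Set.Ioo (0 : ℝ) 1) (hb : ∀ i, 0 < b i) (hR0 : 0 < R)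
    (hR : ValidR b Y Y R) (hσ : ∀ j, Y (σ j) = Y j) :
    Lam q b Y Y 0 σ R = (q : ℂ) ^ invCount σ⁻¹ := by
  have hb' : ∀ i, (b i : ℂ) ≠ 0 := fun i => by exact_mod_cast (hb i).ne'
  have hpre : sitePrefactor b Y * ∏ j, -(b (Y j) : ℂ) = 1 := by
    rw [sitePrefactor, ← Finset.prod_mul_distrib]
    refine Finset.prod_eq_one fun j _ => ?_
    have := hb' (Y j)
    field_simp
  rw [Lam_eq_torusIntegral hq hb hR0 hR]
  simp only [ofReal_zero, mul_zero, exp_zero, mul_one, betheIntegrand_self hσ]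
  rw [torusIntegral_const_mul, torusIntegral_residueStep hq hR0 (fun j => ?_) fun p hp =>
    (mem_inversions.1 hp).1, ← mul_assoc (sitePrefactor b Y), hpre, card_inversions]
  · rw [one_mul, mul_left_comm, ← mul_pow, one_div, inv_mul_cancel₀ two_pi_I_ne_zero, one_pow,
      mul_one]
  · rw [norm_real, Real.norm_of_nonneg (hb _).le]
    exact validR_lt_apply hR j

lemma sum_Lam_self_zero (hq : q ∈ Set.Ioo (0 : ℝ) 1) (hb : ∀ i, 0 < b i) (hR0 : 0 < R)
    (hR : ValidR b Y Y R) (hY : Antitone Y) :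
    ∑ σ : Equiv.Perm (Fin n), Lam q b Y Y 0 σ R = (Wcoef q Y : ℝ) := by
  rw [← sum_stabilizer_pow_invCount hq.2.ne hY, ← Equiv.sum_comp (Equiv.inv _), ofReal_sum]
  refine Finset.sum_congr rfl fun σ _ => ?_
  have hiff : (∀ j, Y ((Equiv.inv _ σ) j) = Y j) ↔ ∀ j, Y (σ j) = Y j := by
    simp only [Equiv.inv_apply]
    refine ⟨fun h j => by simpa using (h (σ j)).symm, fun h j => by simpa using (h (σ⁻¹ j)).symm⟩
  split_ifs with h
  · rw [Lam_self_zero hq hb hR0 hR (hiff.2 h)]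
    simp
  · rw [Lam_zero_eq_zero hq hb hR0 hR hY hY fun h' => h (hiff.1 fun j => (h' j).symm), ofReal_zero]

end Initial

end QTAZRP

/-- the Bethe-ansatz formula `P_Y(X;t) = W(X)⁻¹ Σ_σ Λ_Y(X;t;σ)` satisfies the
`q`-TAZRP master equation and the initial condition `P_Y(·;0) = δ_Y` on `𝕎^n`. -/
theorem transition_probability_qTAZRP
    (q : ℝ) (hq : q ∈ Set.Ioo (0 : ℝ) 1) (a b : ℤ → ℝ)
    (ha : ∀ i, 0 < a i) (hb : ∀ i, b i = a i * (1 - q))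
    (n : ℕ) (Y : Fin (n + 1) → ℤ) (hY : Antitone Y)
    (Rsel : (Fin (n + 1) → ℤ) → ℝ) (hRsel : ∀ X, ValidR b X Y (Rsel X)) :
    MasterEq q a (fun X t => ((Wcoef q X : ℝ) : ℂ)⁻¹ *
        ∑ σ : Equiv.Perm (Fin (n + 1)), Lam q b Y X t σ (Rsel X)) ∧
    ((Wcoef q Y : ℝ) : ℂ)⁻¹ *
        (∑ σ : Equiv.Perm (Fin (n + 1)), Lam q b Y Y 0 σ (Rsel Y)) = 1 ∧
    ∀ X : Fin (n + 1) → ℤ, Antitone X → X ≠ Y →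
      ((Wcoef q X : ℝ) : ℂ)⁻¹ *
        (∑ σ : Equiv.Perm (Fin (n + 1)), Lam q b Y X 0 σ (Rsel X)) = 0 := by
  have hbpos : ∀ i, 0 < b i := fun i => by
    rw [hb]
    exact mul_pos (ha i) (sub_pos.2 hq.2)
  have hR0 : ∀ X, 0 < Rsel X := fun X =>
    (hbpos _).trans (QTAZRP.validR_lt_apply (hRsel X) 0)
  refine ⟨QTAZRP.masterEq_inv_Wcoef_mul_sum_Lam hq hbpos hb hR0 hRsel, ?_, fun X hX hXY => ?_⟩
  · rw [QTAZRP.sum_Lam_self_zero hq hbpos (hR0 Y) (hRsel Y) hY, inv_mul_cancel₀]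
    exact_mod_cast (QTAZRP.Wcoef_pos hq Y).ne'
  · rw [Finset.sum_eq_zero, mul_zero]
    intro σ _
    exact QTAZRP.Lam_zero_eq_zero hq hbpos (hR0 X) (hRsel X) hX hY fun h =>
      hXY (QTAZRP.eq_of_comp_eq hX hY h)
end

section
/- Let n ≥ 1, X ∈ 𝕎^n, t ≥ 0, and let 0⃗ = (0,…,0) ∈ 𝕎^n. Then W(X)^{−1} Σ_{σ ∈ S_n} Λ_{0⃗}(X;t;σ) = [n]_q! · W(X)^{−1} · (∏_{k=1}^{n} (−1/b_{x_k})) · (2πi)^{−n} ∮⋯∮ B(w_1,…,w_n) ∏_{j=1}^{n} [ (∏'_{k=0}^{x_j} b_k/(b_k − w_j)) e^{−w_j t} ] dw_n⋯dw_1, where each contour is the counterclockwise circle |w_j| = R with R > b_k for every integer k in [min_j min(x_j,0) − 1, max_j max(x_j,0)]. (This is the transition probability of the q-TAZRP from the step initial condition y_1 = ⋯ = y_n = 0.) -/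
/-- The product over ordered pairs, evaluated at a permuted tuple, as a product over
pairs `i < j` of the original indices. -/
lemma prod_pairs_comp_perm {n : ℕ} (σ : Equiv.Perm (Fin n)) (h : Fin n → Fin n → ℂ) :
    ∏ p ∈ Finset.univ.filter (fun p : Fin n × Fin n => p.1 < p.2), h (σ p.1) (σ p.2) =
      ∏ p ∈ Finset.univ.filter (fun p : Fin n × Fin n => p.1 < p.2),
        if σ⁻¹ p.1 < σ⁻¹ p.2 then h p.1 p.2 else h p.2 p.1 := by
  refine Finset.prod_bij' (fun p _ => (min (σ p.1) (σ p.2), max (σ p.1) (σ p.2)))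
    (fun p _ => (min (σ⁻¹ p.1) (σ⁻¹ p.2), max (σ⁻¹ p.1) (σ⁻¹ p.2))) ?_ ?_ ?_ ?_ ?_ <;>
  · rintro ⟨i, j⟩ hij
    simp only [Finset.mem_filter, Finset.mem_univ, true_and] at hij ⊢
    have h1 : σ i ≠ σ j := fun h => hij.ne (σ.injective h)
    have h2 : σ.symm i ≠ σ.symm j := fun h => hij.ne (σ.symm.injective h)
    rcases lt_or_gt_of_ne h1 with h3 | h3 <;> rcases lt_or_gt_of_ne h2 with h4 | h4 <;>
      simp [h3, h4, h3.le, h4.le, hij, hij.le, hij.not_gt]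

lemma sign_eq_prod_pairs {n : ℕ} (σ : Equiv.Perm (Fin n)) :
    ((Equiv.Perm.sign σ : ℤ) : ℂ) =
      ∏ p ∈ Finset.univ.filter (fun p : Fin n × Fin n => p.1 < p.2),
        if σ p.1 < σ p.2 then 1 else -1 := by
  rw [σ.sign_eq_prod_prod_Ioi, Finset.prod_filter, ← Finset.univ_product_univ,
    Finset.prod_product]
  push_cast
  refine Finset.prod_congr rfl fun i _ => ?_
  rw [← Finset.prod_filter]
  refine Finset.prod_congr ?_ fun j _ => ?_
  · ext; simp
  · split_ifs <;> simp

lemma sign_mul_prod_pairs {n : ℕ} (σ : Equiv.Perm (Fin n)) (h : Fin n → Fin n → ℂ) :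
    ((Equiv.Perm.sign σ : ℤ) : ℂ) *
      ∏ p ∈ Finset.univ.filter (fun p : Fin n × Fin n => p.1 < p.2), h (σ p.1) (σ p.2) =
      ∏ p ∈ Finset.univ.filter (fun p : Fin n × Fin n => p.1 < p.2),
        if σ⁻¹ p.1 < σ⁻¹ p.2 then h p.1 p.2 else -h p.2 p.1 := by
  rw [prod_pairs_comp_perm, ← Equiv.Perm.sign_inv, sign_eq_prod_pairs, ← Finset.prod_mul_distrib]
  refine Finset.prod_congr rfl fun p _ => ?_
  split_ifs <;> simp

/-- Splitting off the pairs containing the first index. -/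
lemma prod_pairs_succ {n : ℕ} (f : Fin (n + 1) → Fin (n + 1) → ℂ) :
    ∏ p ∈ Finset.univ.filter (fun p : Fin (n + 1) × Fin (n + 1) => p.1 < p.2), f p.1 p.2 =
      (∏ j : Fin n, f 0 j.succ) *
        ∏ p ∈ Finset.univ.filter (fun p : Fin n × Fin n => p.1 < p.2), f p.1.succ p.2.succ := by
  simp only [Finset.prod_filter, ← Finset.univ_product_univ, Finset.prod_product]
  simp [Fin.prod_univ_succ]

/-- Lagrange interpolation of `∏ (x - q w_j) - ∏ (x - w_j)`, evaluated at `0`. -/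
lemma sum_prod_sub_mul_div_sub {ι : Type*} [Fintype ι] [DecidableEq ι] [Nonempty ι] (q : ℂ)
    (hq : q ≠ 1) (w : ι → ℂ) (hw : ∀ i, w i ≠ 0) (hinj : Function.Injective w) :
    ∑ k, ∏ j ∈ Finset.univ.erase k, (w k - q * w j) / (w k - w j) =
      (1 - q ^ Fintype.card ι) / (1 - q) := by
  have hP := Lagrange.eq_interpolate_of_eval_eq (s := Finset.univ) (v := w)
    (f := Lagrange.nodal Finset.univ (fun i => q * w i) - Lagrange.nodal Finset.univ w)
    (fun k => ∏ j, (w k - q * w j)) hinj.injOn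
    (by
      have := Polynomial.degree_sub_lt_left (p := Lagrange.nodal Finset.univ (fun i => q * w i))
        (q := Lagrange.nodal Finset.univ w) (by simp [Lagrange.degree_nodal])
        Lagrange.nodal_ne_zero
        (by rw [Lagrange.nodal_monic.leadingCoeff, Lagrange.nodal_monic.leadingCoeff])
      rwa [Lagrange.degree_nodal] at this)
    (fun i hi => by
      rw [Polynomial.eval_sub, Lagrange.eval_nodal_at_node hi, Lagrange.eval_nodal, sub_zero])
  have h0 := congrArg (Polynomial.eval 0) hP
  have hq1 : 1 - q ≠ 0 := sub_ne_zero.mpr hq.symm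
  have hprod : ∏ i, (0 - w i) ≠ 0 := Finset.prod_ne_zero_iff.mpr fun i _ => by simp [hw i]
  rw [Polynomial.eval_sub, Lagrange.eval_nodal, Lagrange.eval_nodal, Lagrange.interpolate_apply,
    Polynomial.eval_finsetSum] at h0
  have hL : ∏ i, (0 - q * w i) = q ^ Fintype.card ι * ∏ i, (0 - w i) := by
    rw [← Finset.card_univ, ← Finset.prod_const, ← Finset.prod_mul_distrib]
    exact Finset.prod_congr rfl fun i _ => by ring
  have hR : ∀ k : ι, Polynomial.eval 0 (Polynomial.C (∏ j, (w k - q * w j)) *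
      Lagrange.basis Finset.univ w k) = -((1 - q) * ∏ i, (0 - w i)) *
        ∏ j ∈ Finset.univ.erase k, (w k - q * w j) / (w k - w j) := by
    intro k
    rw [Polynomial.eval_mul, Polynomial.eval_C, Lagrange.basis, Polynomial.eval_prod,
      ← Finset.mul_prod_erase _ _ (Finset.mem_univ k),
      ← Finset.mul_prod_erase _ (fun i => 0 - w i) (Finset.mem_univ k)]
    have : ∀ j, Polynomial.eval 0 (Lagrange.basisDivisor (w k) (w j)) =
        (0 - w j) / (w k - w j) := by
      intro j; simp [Lagrange.basisDivisor, div_eq_inv_mul]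
    simp only [this, Finset.prod_div_distrib]
    ring
  rw [Finset.sum_congr rfl fun k _ => hR k, ← Finset.mul_sum, hL] at h0
  rw [eq_div_iff hq1]
  apply mul_left_cancel₀ hprod
  linear_combination h0

/-- Symmetrization identity for the Hall-Littlewood kernel. -/
lemma sum_perm_prod_div {q : ℝ} (hq : q ≠ 1) (n : ℕ) (w : Fin n → ℂ) (hw : ∀ i, w i ≠ 0)
    (hinj : Function.Injective w) :
    ∑ σ : Equiv.Perm (Fin n),
      ∏ p ∈ Finset.univ.filter (fun p : Fin n × Fin n => p.1 < p.2),
        (w (σ p.1) - q * w (σ p.2)) / (w (σ p.1) - w (σ p.2)) = (qfac q n : ℝ) := by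
  induction n with
  | zero => simp [qfac]
  | succ n ih =>
    have hqC : (q : ℂ) ≠ 1 := by exact_mod_cast hq
    rw [← Equiv.Perm.decomposeFin.symm.sum_comp, Fintype.sum_prod_type]
    have key : ∀ k : Fin (n + 1), ∑ e : Equiv.Perm (Fin n),
        ∏ p ∈ Finset.univ.filter (fun p : Fin (n + 1) × Fin (n + 1) => p.1 < p.2),
          (w (Equiv.Perm.decomposeFin.symm (k, e) p.1) -
            q * w (Equiv.Perm.decomposeFin.symm (k, e) p.2)) /
          (w (Equiv.Perm.decomposeFin.symm (k, e) p.1) -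
            w (Equiv.Perm.decomposeFin.symm (k, e) p.2)) =
        (∏ j ∈ Finset.univ.erase k, (w k - q * w j) / (w k - w j)) * (qfac q n : ℝ) := by
      intro k
      have hinj' : Function.Injective fun i : Fin n => w (Equiv.swap 0 k i.succ) :=
        hinj.comp ((Equiv.swap 0 k).injective.comp (Fin.succ_injective n))
      rw [← ih _ (fun i => hw _) hinj', Finset.mul_sum]
      refine Finset.sum_congr rfl fun e _ => ?_
      rw [prod_pairs_succ fun i j => (w (Equiv.Perm.decomposeFin.symm (k, e) i) -
            q * w (Equiv.Perm.decomposeFin.symm (k, e) j)) /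
          (w (Equiv.Perm.decomposeFin.symm (k, e) i) -
            w (Equiv.Perm.decomposeFin.symm (k, e) j))]
      simp only [Equiv.Perm.decomposeFin_symm_apply_zero, Equiv.Perm.decomposeFin_symm_apply_succ]
      congr 1
      rw [Equiv.prod_comp e fun j => (w k - q * w (Equiv.swap 0 k j.succ)) /
        (w k - w (Equiv.swap 0 k j.succ))]
      have herase : Finset.univ.erase k =
          Finset.univ.image fun j : Fin n => Equiv.swap 0 k j.succ := by
        ext i
        simp only [Finset.mem_erase, Finset.mem_univ, and_true, Finset.mem_image, true_and]
        constructor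
        · intro hi
          have : Equiv.swap 0 k i ≠ 0 := fun h =>
            hi ((Equiv.swap 0 k).injective (h.trans (Equiv.swap_apply_right 0 k).symm))
          obtain ⟨j, hj⟩ := Fin.exists_succ_eq.mpr this
          exact ⟨j, by rw [hj, Equiv.swap_apply_self]⟩
        · rintro ⟨j, rfl⟩ h
          have := congrArg (Equiv.swap 0 k) h
          simp at this
      rw [herase, Finset.prod_image fun i _ j _ h =>
        Fin.succ_injective n ((Equiv.swap 0 k).injective h)]
    rw [Finset.sum_congr rfl fun k _ => key k, ← Finset.sum_mul,
      sum_prod_sub_mul_div_sub _ hqC w hw hinj, qfac, qfac,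
      Finset.prod_Icc_succ_top (by omega), mul_comm]
    simp

/-- Antisymmetrizing `∏_{i<j} (w_i - q w_j)` gives `[n]_q!` times the Vandermonde product. -/
lemma sum_sign_mul_prod {q : ℝ} (hq : q ≠ 1) (n : ℕ) (w : Fin n → ℂ) (hw : ∀ i, w i ≠ 0) :
    ∑ σ : Equiv.Perm (Fin n), ((Equiv.Perm.sign σ : ℤ) : ℂ) *
      ∏ p ∈ Finset.univ.filter (fun p : Fin n × Fin n => p.1 < p.2),
        (w (σ p.1) - q * w (σ p.2)) =
      (qfac q n : ℝ) *
        ∏ p ∈ Finset.univ.filter (fun p : Fin n × Fin n => p.1 < p.2), (w p.1 - w p.2) := by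
  by_cases hinj : Function.Injective w
  · rw [← sum_perm_prod_div hq n w hw hinj, Finset.sum_mul]
    refine Finset.sum_congr rfl fun σ _ => ?_
    have hV := sign_mul_prod_pairs σ fun i j => w i - w j
    simp only [neg_sub, ite_self] at hV
    rw [← hV, Finset.prod_div_distrib, mul_left_comm]
    congr 1
    refine (div_mul_cancel₀ _ (Finset.prod_ne_zero_iff.mpr fun p hp => ?_)).symm
    rw [Finset.mem_filter] at hp
    exact sub_ne_zero.mpr fun h => hp.2.ne (σ.injective (hinj h))
  · obtain ⟨a, b, hab, hne⟩ : ∃ a b, w a = w b ∧ a ≠ b := by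
      simpa [Function.Injective] using hinj
    have hswap : ∀ i, w (Equiv.swap a b i) = w i := by
      intro i
      rcases eq_or_ne i a with rfl | hi
      · simp [hab]
      rcases eq_or_ne i b with rfl | hi'
      · simp [hab]
      rw [Equiv.swap_apply_of_ne_of_ne hi hi']
    have hS : ∀ S : ℂ, S = -S → S = 0 := fun S h => by linear_combination h / 2
    have hL : (∑ σ : Equiv.Perm (Fin n), ((Equiv.Perm.sign σ : ℤ) : ℂ) *
      ∏ p ∈ Finset.univ.filter (fun p : Fin n × Fin n => p.1 < p.2),
        (w (σ p.1) - q * w (σ p.2))) = 0 := by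
      apply hS
      conv_lhs => rw [← Equiv.sum_comp (Equiv.mulLeft (Equiv.swap a b))]
      rw [← Finset.sum_neg_distrib]
      refine Finset.sum_congr rfl fun σ _ => ?_
      simp [Equiv.Perm.sign_swap hne, hswap]
    rw [hL, eq_comm]
    refine mul_eq_zero_of_right _ (Finset.prod_eq_zero_iff.mpr ?_)
    rcases lt_or_gt_of_ne hne with h | h
    · exact ⟨(a, b), by simpa using h, by simp [hab]⟩
    · exact ⟨(b, a), by simpa using h, by simp [hab]⟩

lemma Acoef_comp_inv_mul_prod (q : ℝ) {n : ℕ} (σ : Equiv.Perm (Fin n)) (w : Fin n → ℂ)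
    (hw : ∀ i j, w i - q * w j ≠ 0) :
    Acoef q σ (fun i => w (σ⁻¹ i)) *
        ∏ p ∈ Finset.univ.filter (fun p : Fin n × Fin n => p.1 < p.2), (w p.1 - q * w p.2) =
      ((Equiv.Perm.sign σ⁻¹ : ℤ) : ℂ) *
        ∏ p ∈ Finset.univ.filter (fun p : Fin n × Fin n => p.1 < p.2),
          (w (σ⁻¹ p.1) - q * w (σ⁻¹ p.2)) := by
  rw [sign_mul_prod_pairs σ⁻¹ fun i j => w i - q * w j]
  have hA : Acoef q σ (fun i => w (σ⁻¹ i)) =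
      ∏ p ∈ Finset.univ.filter (fun p : Fin n × Fin n => p.1 < p.2),
        if σ p.2 < σ p.1 then (q * w p.1 - w p.2) / (w p.1 - q * w p.2) else 1 := by
    rw [← Finset.prod_filter, Finset.filter_filter, Acoef]
    refine Finset.prod_bij' (fun p _ => (σ⁻¹ p.1, σ⁻¹ p.2)) (fun p _ => (σ p.1, σ p.2))
      ?_ ?_ ?_ ?_ ?_
    · rintro p hp; simpa [and_comm] using hp
    · rintro p hp; simpa [and_comm] using hp
    · simp
    · simp
    · intro p _
      rw [← neg_sub (w (σ⁻¹ p.1)), neg_div_neg_eq]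
  rw [hA, ← Finset.prod_mul_distrib]
  refine Finset.prod_congr rfl fun p hp => ?_
  rw [Finset.mem_filter] at hp
  have hne : σ p.1 ≠ σ p.2 := fun h => hp.2.ne (σ.injective h)
  rw [inv_inv]
  rcases lt_or_gt_of_ne hne with h | h
  · simp [h, h.not_gt]
  · simp [h, h.not_gt, div_mul_cancel₀ _ (hw p.1 p.2)]

lemma sum_Acoef_comp_inv {q : ℝ} (hq : q ≠ 1) {n : ℕ} (w : Fin n → ℂ) (hw0 : ∀ i, w i ≠ 0)
    (hw : ∀ i j, w i - q * w j ≠ 0) :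
    ∑ σ : Equiv.Perm (Fin n), Acoef q σ (fun i => w (σ⁻¹ i)) = (qfac q n : ℝ) * Bcoef q w := by
  have hne : ∏ p ∈ Finset.univ.filter (fun p : Fin n × Fin n => p.1 < p.2),
      (w p.1 - q * w p.2) ≠ 0 := Finset.prod_ne_zero_iff.mpr fun p _ => hw _ _
  apply mul_right_cancel₀ hne
  have hinv := Equiv.sum_comp (Equiv.inv (Equiv.Perm (Fin n))) fun σ =>
    ((Equiv.Perm.sign σ : ℤ) : ℂ) *
      ∏ p ∈ Finset.univ.filter (fun p : Fin n × Fin n => p.1 < p.2),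
        (w (σ p.1) - q * w (σ p.2))
  simp only [Equiv.inv_apply] at hinv
  rw [Finset.sum_mul, Finset.sum_congr rfl fun σ _ => Acoef_comp_inv_mul_prod q σ w hw,
    hinv, sum_sign_mul_prod hq n w hw0, Bcoef,
    Finset.prod_div_distrib, mul_assoc, div_mul_cancel₀ _ hne]

/-- The torus of polyradius `(R, …, R)` centred at the origin. -/
def torusSet (n : ℕ) (R : ℝ) : Set (Fin n → ℂ) := {w | ∀ i, ‖w i‖ = R}

lemma torusMap_mem_torusSet {n : ℕ} {R : ℝ} (hR : 0 ≤ R) (θ : Fin n → ℝ) :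
    torusMap 0 (fun _ => R) θ ∈ torusSet n R := by
  intro i
  simp [torusMap, Complex.norm_exp_ofReal_mul_I, abs_of_nonneg hR]

lemma torusIntegrable_of_continuousOn {n : ℕ} {R : ℝ} (hR : 0 ≤ R) {f : (Fin n → ℂ) → ℂ}
    (hf : ContinuousOn f (torusSet n R)) : TorusIntegrable f 0 (fun _ => R) := by
  have hc : Continuous (torusMap (0 : Fin n → ℂ) fun _ => R) := by
    unfold torusMap
    fun_prop
  exact (hf.comp_continuous hc (torusMap_mem_torusSet hR)).continuousOn.integrableOn_compact
    isCompact_Icc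

lemma torusIntegral_congr_torusSet {n : ℕ} {R : ℝ} (hR : 0 ≤ R) {f g : (Fin n → ℂ) → ℂ}
    (h : Set.EqOn f g (torusSet n R)) :
    torusIntegral f 0 (fun _ => R) = torusIntegral g 0 (fun _ => R) := by
  unfold torusIntegral
  congr 1
  ext θ
  rw [h (torusMap_mem_torusSet hR θ)]

lemma torusIntegral_finset_sum {n : ℕ} {R : ℝ} (hR : 0 ≤ R) {ι : Type*} (s : Finset ι)
    {f : ι → (Fin n → ℂ) → ℂ} (hf : ∀ i ∈ s, ContinuousOn (f i) (torusSet n R)) :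
    torusIntegral (fun w => ∑ i ∈ s, f i w) 0 (fun _ => R) =
      ∑ i ∈ s, torusIntegral (f i) 0 (fun _ => R) := by
  simp only [torusIntegral, Finset.smul_sum]
  exact MeasureTheory.integral_finsetSum _ fun i hi =>
    (torusIntegrable_of_continuousOn hR (hf i hi)).function_integrable

/-- The iterated contour integral of a continuous function is the integral over the torus. -/
lemma mcInt_eq_torusIntegral {R : ℝ} (hR : 0 ≤ R) (n : ℕ) {f : (Fin n → ℂ) → ℂ}
    (hf : ContinuousOn f (torusSet n R)) : mcInt n R f = torusIntegral f 0 (fun _ => R) := by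
  induction n with
  | zero =>
    rw [mcInt, torusIntegral_dim0]
    congr 1
    exact Subsingleton.elim _ _
  | succ n ih =>
    rw [mcInt, torusIntegral_succ (torusIntegrable_of_continuousOn hR hf)]
    refine circleIntegral.integral_congr hR fun z hz => ?_
    refine ih (hf.comp (by fun_prop) fun w hw i => ?_)
    refine Fin.cases ?_ (fun j => ?_) i
    · simpa using hz
    · simpa using hw j

/-- Invariance of the torus integral under permutations of the variables. -/
lemma torusIntegral_comp_perm {n : ℕ} (R : ℝ) (σ : Equiv.Perm (Fin n)) (f : (Fin n → ℂ) → ℂ) :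
    torusIntegral (fun w => f fun i => w (σ i)) 0 (fun _ => R) =
      torusIntegral f 0 (fun _ => R) := by
  have hmp := MeasureTheory.volume_measurePreserving_piCongrLeft (fun _ : Fin n => ℝ) σ.symm
  have happ : ∀ (θ : Fin n → ℝ),
      MeasurableEquiv.piCongrLeft (fun _ : Fin n => ℝ) σ.symm θ = fun i => θ (σ i) := by
    intro θ
    ext i
    have := MeasurableEquiv.piCongrLeft_apply_apply (β := fun _ : Fin n => ℝ) σ.symm θ (σ i)
    simpa using this
  unfold torusIntegral
  conv_rhs => rw [← hmp.setIntegral_preimage_emb (MeasurableEquiv.measurableEmbedding _)]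
  have hpre : MeasurableEquiv.piCongrLeft (fun _ : Fin n => ℝ) σ.symm ⁻¹'
      Set.Icc (0 : Fin n → ℝ) (fun _ => 2 * Real.pi) =
      Set.Icc (0 : Fin n → ℝ) (fun _ => 2 * Real.pi) := by
    ext θ
    simp only [Set.mem_preimage, happ, Set.mem_Icc, Pi.le_def, Pi.zero_apply]
    rw [σ.forall_congr_right (q := fun i => 0 ≤ θ i),
      σ.forall_congr_right (q := fun i => θ i ≤ 2 * Real.pi)]
  rw [hpre]
  congr 1
  ext θ
  rw [happ]
  congr 1
  exact (Equiv.prod_comp σ fun i => (R : ℂ) * Complex.exp (θ i * Complex.I) * Complex.I).symm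

lemma continuousOn_eprod {n : ℕ} {b : ℤ → ℝ} {X : Fin n → ℤ} {R : ℝ}
    (hb : ∀ k, 0 < b k) (hR : ValidR b X (fun _ => 0) R) (j : Fin n) :
    ContinuousOn (fun z : ℂ => eprod (fun k => (b k : ℂ) / ((b k : ℂ) - z)) 0 (X j))
      (Metric.sphere 0 R) := by
  unfold eprod
  split_ifs with h
  · refine continuousOn_finsetProd _ fun k hk => ContinuousOn.div (by fun_prop) (by fun_prop) ?_
    intro z hz h0
    rw [Finset.mem_Icc] at hk
    have hk' : b k < R := hR k ⟨j, by simp; omega⟩ ⟨j, by simp; omega⟩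
    rw [mem_sphere_zero_iff_norm, ← sub_eq_zero.mp h0, Complex.norm_real, Real.norm_eq_abs,
      abs_of_pos (hb k)] at hz
    exact hk'.ne hz
  · refine continuousOn_finsetProd _ fun k hk => ?_
    simp only [inv_div]
    fun_prop

lemma sub_mul_ne_zero_of_mem_torusSet {n : ℕ} {R q : ℝ} (hR : 0 < R)
    (hq : q ∈ Set.Ioo (0 : ℝ) 1) {w : Fin n → ℂ} (hw : w ∈ torusSet n R) (i j : Fin n) :
    w i - q * w j ≠ 0 := by
  intro h
  have h' := congrArg norm (sub_eq_zero.mp h)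
  rw [norm_mul, Complex.norm_real, Real.norm_eq_abs, abs_of_pos hq.1, hw i, hw j] at h'
  nlinarith [hq.2]

lemma continuousOn_Acoef {n : ℕ} {R q : ℝ} (hR : 0 < R) (hq : q ∈ Set.Ioo (0 : ℝ) 1)
    (σ : Equiv.Perm (Fin n)) : ContinuousOn (Acoef q σ) (torusSet n R) := by
  refine continuousOn_finsetProd _ fun p _ => ContinuousOn.div (by fun_prop) (by fun_prop) ?_
  intro w hw
  rw [← neg_sub, neg_ne_zero]
  exact sub_mul_ne_zero_of_mem_torusSet hR hq hw p.1 p.2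

/-- transition probability from the step initial condition `y_1 = ⋯ = y_n = 0`. -/
theorem step_initial_condition
    (q : ℝ) (hq : q ∈ Set.Ioo (0 : ℝ) 1) (a b : ℤ → ℝ)
    (ha : ∀ i, 0 < a i) (hb : ∀ i, b i = a i * (1 - q))
    (n : ℕ) (X : Fin (n + 1) → ℤ) (hX : Antitone X) (t : ℝ) (ht : 0 ≤ t)
    (R : ℝ) (hR : ValidR b X (fun _ => 0) R) :
    ((Wcoef q X : ℝ) : ℂ)⁻¹ *
        ∑ σ : Equiv.Perm (Fin (n + 1)), Lam q b (fun _ => 0) X t σ R =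
      (qfac q (n + 1) : ℝ) * ((Wcoef q X : ℝ) : ℂ)⁻¹ *
        (∏ k, (-1 : ℂ) / (b (X k) : ℂ)) *
        (1 / (2 * Real.pi * Complex.I)) ^ (n + 1) *
        mcInt (n + 1) R (fun w => Bcoef q w *
          ∏ j, (eprod (fun k => (b k : ℂ) / ((b k : ℂ) - w j)) 0 (X j) *
            Complex.exp (-(w j) * (t : ℂ)))) := by
  have hq1 : (0 : ℝ) < 1 - q := sub_pos.mpr hq.2
  have hbpos : ∀ k, 0 < b k := fun k => hb k ▸ mul_pos (ha k) hq1
  have hRpos : 0 < R := (hbpos (-1)).trans (hR (-1) ⟨0, by simp⟩ ⟨0, by simp⟩)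
  have hne : ∀ w ∈ torusSet (n + 1) R, ∀ i j, w i - q * w j ≠ 0 := fun w hw =>
    sub_mul_ne_zero_of_mem_torusSet hRpos hq hw
  have hsub : ∀ i : Fin (n + 1), Set.MapsTo (fun w : Fin (n + 1) → ℂ => w i)
      (torusSet (n + 1) R) (Metric.sphere 0 R) := fun i w hw => by simpa using hw i
  have hcE : ∀ i j : Fin (n + 1), ContinuousOn (fun w : Fin (n + 1) → ℂ =>
      eprod (fun k => (b k : ℂ) / ((b k : ℂ) - w i)) 0 (X j)) (torusSet (n + 1) R) := fun i j =>
    (continuousOn_eprod hbpos hR j).comp (by fun_prop) (hsub i)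
  have hcexp : ∀ j : Fin (n + 1), ContinuousOn (fun w : Fin (n + 1) → ℂ =>
      Complex.exp (-(w j) * (t : ℂ))) (torusSet (n + 1) R) := fun j => by fun_prop
  have hcA : ∀ σ : Equiv.Perm (Fin (n + 1)), ContinuousOn (fun w : Fin (n + 1) → ℂ =>
      Acoef q σ w * ∏ j, (eprod (fun k => (b k : ℂ) / ((b k : ℂ) - w (σ j))) 0 (X j) *
        Complex.exp (-(w j) * (t : ℂ)))) (torusSet (n + 1) R) := fun σ =>
    (continuousOn_Acoef hRpos hq σ).mul
      (continuousOn_finsetProd _ fun j _ => (hcE (σ j) j).mul (hcexp j))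
  have hcB : ContinuousOn (fun w : Fin (n + 1) → ℂ =>
      Bcoef q w * ∏ j, (eprod (fun k => (b k : ℂ) / ((b k : ℂ) - w j)) 0 (X j) *
        Complex.exp (-(w j) * (t : ℂ)))) (torusSet (n + 1) R) :=
    (continuousOn_finsetProd _ fun p _ => ContinuousOn.div (by fun_prop) (by fun_prop)
      fun w hw => hne w hw p.1 p.2).mul
      (continuousOn_finsetProd _ fun j _ => (hcE j j).mul (hcexp j))
  have hsum : ∑ σ : Equiv.Perm (Fin (n + 1)), mcInt (n + 1) R (fun w =>
      Acoef q σ w * ∏ j, (eprod (fun k => (b k : ℂ) / ((b k : ℂ) - w (σ j))) 0 (X j) *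
        Complex.exp (-(w j) * (t : ℂ)))) =
      (qfac q (n + 1) : ℝ) * mcInt (n + 1) R (fun w => Bcoef q w *
          ∏ j, (eprod (fun k => (b k : ℂ) / ((b k : ℂ) - w j)) 0 (X j) *
            Complex.exp (-(w j) * (t : ℂ)))) := by
    rw [mcInt_eq_torusIntegral hRpos.le _ hcB, ← torusIntegral_const_mul]
    have hperm : ∀ σ : Equiv.Perm (Fin (n + 1)), mcInt (n + 1) R (fun w =>
        Acoef q σ w * ∏ j, (eprod (fun k => (b k : ℂ) / ((b k : ℂ) - w (σ j))) 0 (X j) *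
          Complex.exp (-(w j) * (t : ℂ)))) =
        torusIntegral (fun w => Acoef q σ (fun i => w (σ⁻¹ i)) *
          ∏ j, (eprod (fun k => (b k : ℂ) / ((b k : ℂ) - w j)) 0 (X j) *
            Complex.exp (-(w j) * (t : ℂ)))) 0 (fun _ => R) := by
      intro σ
      rw [mcInt_eq_torusIntegral hRpos.le _ (hcA σ), ← torusIntegral_comp_perm R σ⁻¹]
      congr 1
      ext w
      rw [Finset.prod_mul_distrib, Finset.prod_mul_distrib,
        Equiv.prod_comp σ⁻¹ fun j => Complex.exp (-(w j) * (t : ℂ))]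
      simp
    rw [Finset.sum_congr rfl fun σ _ => hperm σ, ← torusIntegral_finset_sum hRpos.le]
    · refine torusIntegral_congr_torusSet hRpos.le fun w hw => ?_
      have hw0 : ∀ i, w i ≠ 0 := fun i => norm_pos_iff.mp ((hw i).symm ▸ hRpos)
      simp only [← Finset.sum_mul]
      rw [sum_Acoef_comp_inv hq.2.ne w hw0 (hne w hw), mul_assoc]
    · intro σ _
      refine ContinuousOn.mul ?_
        (continuousOn_finsetProd _ fun j _ => (hcE j j).mul (hcexp j))
      exact (continuousOn_Acoef hRpos hq σ).comp (by fun_prop) fun w hw i => hw _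
  simp only [Lam]
  rw [← Finset.mul_sum, hsum]
  ring
end

section
/- Let n ≥ 1 and suppose u⁰(X;·) : [0,∞) → ℂ, X ∈ ℤ^n, is a family of differentiable functions satisfying the free evolution equation and the boundary conditions. Define u(X;t) = W(X)^{−1} u⁰(X;t) for X ∈ 𝕎^n and t ≥ 0. Then the family u(X;·) satisfies the q-TAZRP master equation. -/
theorem cnt_update_add {n : ℕ} (X : Fin n → ℤ) (L : Fin n) (w v : ℤ) :
    cnt (Function.update X L w) v + (if X L = v then 1 else 0) =
      cnt X v + if w = v then 1 else 0 := by
  unfold cnt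
  rw [Finset.card_filter, Finset.card_filter, ← Finset.add_sum_erase _ _ (Finset.mem_univ L),
    ← Finset.add_sum_erase Finset.univ (fun j => if X j = v then 1 else 0) (Finset.mem_univ L)]
  have h : ∑ j ∈ Finset.univ.erase L, (if Function.update X L w j = v then 1 else 0) =
      ∑ j ∈ Finset.univ.erase L, if X j = v then 1 else 0 :=
    Finset.sum_congr rfl fun j hj => by
      rw [Function.update_of_ne (Finset.ne_of_mem_erase hj)]
  rw [h, Function.update_self]
  ring

theorem qfac_succ (q : ℝ) (k : ℕ) :
    qfac q (k + 1) = qfac q k * ((1 - q ^ (k + 1)) / (1 - q)) := by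
  unfold qfac
  rw [Finset.prod_Icc_succ_top (by omega)]

theorem qfac_pos {q : ℝ} (hq : q ∈ Set.Ioo (0 : ℝ) 1) (k : ℕ) : 0 < qfac q k := by
  unfold qfac
  refine Finset.prod_pos fun j hj => ?_
  have hj : j ≠ 0 := by have := (Finset.mem_Icc.1 hj).1; omega
  exact div_pos (sub_pos.2 (pow_lt_one₀ hq.1.le hq.2 hj)) (sub_pos.2 hq.2)

theorem Wcoef_pos {q : ℝ} (hq : q ∈ Set.Ioo (0 : ℝ) 1) {n : ℕ} (X : Fin n → ℤ) :
    0 < Wcoef q X :=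
  Finset.prod_pos fun _ _ => qfac_pos hq _

theorem Wcoef_eq_prod_of_subset (q : ℝ) {n : ℕ} (X : Fin n → ℤ) {S : Finset ℤ}
    (hS : Finset.univ.image X ⊆ S) : Wcoef q X = ∏ s ∈ S, qfac q (cnt X s) := by
  unfold Wcoef
  refine Finset.prod_subset hS fun s _ hs => ?_
  have h : cnt X s = 0 := by
    unfold cnt
    rw [Finset.card_eq_zero, Finset.filter_eq_empty_iff]
    exact fun j _ hj => hs (Finset.mem_image.2 ⟨j, Finset.mem_univ j, hj⟩)
  simp [h, qfac]

theorem Wcoef_update_mul {q : ℝ} {n : ℕ} (X : Fin n → ℤ) (L : Fin n) :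
    Wcoef q (Function.update X L (X L - 1)) * (1 - q ^ cnt X (X L)) =
      Wcoef q X * (1 - q ^ cnt (Function.update X L (X L - 1)) (X L - 1)) := by
  set s := X L with hs
  set Y := Function.update X L (s - 1) with hY
  have hne : s - 1 ≠ s := by omega
  have hsX : cnt X s = cnt Y s + 1 := by
    have := cnt_update_add X L (s - 1) s
    simpa [← hs, ← hY, hne] using this.symm
  have hsY : cnt Y (s - 1) = cnt X (s - 1) + 1 := by
    have := cnt_update_add X L (s - 1) (s - 1)
    simpa [← hs, ← hY, hne.symm] using this
  have hother : ∀ v, v ≠ s → v ≠ s - 1 → cnt Y v = cnt X v := fun v h1 h2 => by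
    have := cnt_update_add X L (s - 1) v
    simpa [← hs, ← hY, h1.symm, h2.symm] using this
  set S := insert (s - 1) (Finset.univ.image X) with hS
  have hXS : Finset.univ.image X ⊆ S := Finset.subset_insert _ _
  have hYS : Finset.univ.image Y ⊆ S := by
    intro v hv
    obtain ⟨j, -, rfl⟩ := Finset.mem_image.1 hv
    rcases eq_or_ne j L with rfl | hj
    · simp [hY, hS]
    · rw [hY, Function.update_of_ne hj]
      exact hXS (Finset.mem_image_of_mem X (Finset.mem_univ j))
  have hmem : s ∈ S := hXS (Finset.mem_image_of_mem X (Finset.mem_univ L))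
  have hmem' : s - 1 ∈ S.erase s := Finset.mem_erase.2 ⟨hne, Finset.mem_insert_self _ _⟩
  rw [Wcoef_eq_prod_of_subset q X hXS, Wcoef_eq_prod_of_subset q Y hYS,
    ← Finset.mul_prod_erase _ _ hmem, ← Finset.mul_prod_erase _ _ hmem',
    ← Finset.mul_prod_erase S (fun v => qfac q (cnt X v)) hmem,
    ← Finset.mul_prod_erase (S.erase s) (fun v => qfac q (cnt X v)) hmem']
  have hprod : ∏ v ∈ (S.erase s).erase (s - 1), qfac q (cnt Y v) =
      ∏ v ∈ (S.erase s).erase (s - 1), qfac q (cnt X v) :=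
    Finset.prod_congr rfl fun v hv => by
      rw [Finset.mem_erase, Finset.mem_erase] at hv
      rw [hother v hv.2.1 hv.1]
  rw [hprod, hsX, hsY, qfac_succ, qfac_succ]
  ring

/-- The level set of a weakly decreasing tuple at an attained value is an interval, whose right
end is the coordinate lowered by `lowerLast`. -/
theorem exists_level_eq_Icc {n : ℕ} {X : Fin n → ℤ} (hX : Antitone X) {s : ℤ}
    (hs : s ∈ Finset.univ.image X) :
    ∃ m L : Fin n, m ≤ L ∧ X L = s ∧
      Finset.univ.filter (fun j => X j = s) = Finset.Icc m L ∧
      lowerLast X s = Function.update X L (X L - 1) := by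
  set F := Finset.univ.filter (fun j => X j = s) with hF
  have hmemF : ∀ j, j ∈ F ↔ X j = s := fun j => by simp [hF]
  have hne : F.Nonempty := by
    obtain ⟨j, -, hj⟩ := Finset.mem_image.1 hs
    exact ⟨j, (hmemF j).2 hj⟩
  have hm := (hmemF _).1 (F.min'_mem hne)
  have hL := (hmemF _).1 (F.max'_mem hne)
  refine ⟨F.min' hne, F.max' hne, F.min'_le _ (F.max'_mem hne), hL, ?_, ?_⟩
  · ext j
    rw [Finset.mem_Icc]
    refine ⟨fun hj => ⟨F.min'_le _ hj, F.le_max' _ hj⟩, fun hj => (hmemF j).2 ?_⟩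
    exact le_antisymm (hm ▸ hX hj.1) (hL ▸ hX hj.2)
  · funext j
    unfold lowerLast
    rcases eq_or_ne j (F.max' hne) with hj | hj
    · have h : X j = s ∧ ∀ i, j < i → X i ≠ s := by
        refine ⟨hj ▸ hL, fun i hi his => ?_⟩
        exact absurd (F.le_max' i ((hmemF i).2 his)) (not_le.2 (hj ▸ hi))
      rw [if_pos h, hj, Function.update_self]
    · have h : ¬(X j = s ∧ ∀ i, j < i → X i ≠ s) := fun h =>
        h.2 _ (lt_of_le_of_ne (F.le_max' j ((hmemF j).2 h.1)) hj) hL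
      rw [if_neg h, Function.update_of_ne hj]

/-- A family on an interval satisfying `g j = q * g (j + 1)` sums as a geometric progression. -/
theorem one_sub_mul_sum_Icc_of_geometric {n : ℕ} (q : ℂ) (g : Fin n → ℂ) {m L : Fin n}
    (hmL : m ≤ L)
    (hg : ∀ (k : ℕ) (h : k + 1 < n), (m : ℕ) ≤ k → k + 1 ≤ (L : ℕ) →
      g ⟨k, by omega⟩ = q * g ⟨k + 1, h⟩) :
    (1 - q) * ∑ j ∈ Finset.Icc m L, g j = (1 - q ^ (Finset.Icc m L).card) * g L := by
  have hmL' : (m : ℕ) ≤ L := hmL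
  have hpow : ∀ d : ℕ, (hd : (m : ℕ) + d ≤ L) →
      g ⟨(L : ℕ) - d, by omega⟩ = q ^ d * g L := by
    intro d
    induction d with
    | zero => intro _; simp
    | succ d ih =>
      intro hd
      have hstep := hg ((L : ℕ) - (d + 1)) (by omega) (by omega) (by omega)
      have hidx : (⟨(L : ℕ) - (d + 1) + 1, by omega⟩ : Fin n) = ⟨(L : ℕ) - d, by omega⟩ :=
        Fin.ext (by simp only; omega)
      rw [hstep, hidx, ih (by omega), pow_succ]
      ring
  have hsum : ∑ j ∈ Finset.Icc m L, g j =
      ∑ d ∈ Finset.range (Finset.Icc m L).card, q ^ d * g L := by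
    rw [Fin.card_Icc]
    refine Finset.sum_bij' (fun j _ => (L : ℕ) - j) (fun d _ => ⟨(L : ℕ) - d, by omega⟩)
      ?_ ?_ ?_ ?_ ?_
    · intro j hj
      have := Finset.mem_Icc.1 hj
      simp only [Fin.le_def] at this
      rw [Finset.mem_range]
      omega
    · intro d hd
      rw [Finset.mem_range] at hd
      rw [Finset.mem_Icc, Fin.le_def, Fin.le_def]
      simp only
      omega
    · intro j hj
      have := Finset.mem_Icc.1 hj
      simp only [Fin.le_def] at this
      exact Fin.ext (by simp only; omega)
    · intro d hd
      rw [Finset.mem_range] at hd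
      simp only
      omega
    · intro j hj
      have := Finset.mem_Icc.1 hj
      simp only [Fin.le_def] at this
      rw [← hpow ((L : ℕ) - j) (by omega)]
      congr 1
      exact Fin.ext (by simp only; omega)
  rw [hsum, ← Finset.sum_mul, ← mul_assoc, mul_neg_geom_sum]

/-- The boundary conditions relate lowering two adjacent coordinates of equal value. -/
theorem BoundaryCond.update_sub_eq {q : ℝ} {b : ℤ → ℝ} {n : ℕ} {u : (Fin n → ℤ) → ℝ → ℂ}
    (hbc : BoundaryCond q b u) {X : Fin n → ℤ} {s : ℤ} {k : ℕ} (h : k + 1 < n)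
    (hk : X ⟨k, by omega⟩ = s) (hk' : X ⟨k + 1, h⟩ = s) {t : ℝ} (ht : 0 ≤ t) :
    (b (s - 1) : ℂ) * u (Function.update X ⟨k, by omega⟩ (s - 1)) t - (b s : ℂ) * u X t =
      q * ((b (s - 1) : ℂ) * u (Function.update X ⟨k + 1, h⟩ (s - 1)) t
        - (b s : ℂ) * u X t) := by
  have hne : (⟨k + 1, h⟩ : Fin n) ≠ ⟨k, by omega⟩ := by simp
  have hupd : Function.update X ⟨k, by omega⟩ s = X := Function.update_eq_self_iff.2 hk.symm
  have h1 : set2 X k h (s - 1) s = Function.update X ⟨k, by omega⟩ (s - 1) := by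
    unfold set2
    rw [Function.update_eq_self_iff, Function.update_of_ne hne, hk']
  have h2 : set2 X k h s (s - 1) = Function.update X ⟨k + 1, h⟩ (s - 1) := by
    unfold set2
    rw [hupd]
  have h3 : set2 X k h s s = X := by
    unfold set2
    rw [hupd, Function.update_eq_self_iff.2 hk'.symm]
  have := hbc k h X s t ht
  rw [h1, h2, h3] at this
  linear_combination this

/-- a solution of the free evolution equation with boundary conditions yields,
after division by `W(X)`, a solution of the `q`-TAZRP master equation. -/
theorem master_eq_from_free_evolution
    (q : ℝ) (hq : q ∈ Set.Ioo (0 : ℝ) 1) (a b : ℤ → ℝ)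
    (ha : ∀ i, 0 < a i) (hb : ∀ i, b i = a i * (1 - q))
    (n : ℕ) (u0 : (Fin (n + 1) → ℤ) → ℝ → ℂ)
    (hfree : FreeEvol b u0) (hbc : BoundaryCond q b u0) :
    MasterEq q a (fun X t => ((Wcoef q X : ℝ) : ℂ)⁻¹ * u0 X t) := by
  intro X hX t ht
  have hq1 : (1 - (q : ℂ)) ≠ 0 := by
    exact_mod_cast (sub_pos.2 hq.2).ne'
  have hW : ∀ Y : Fin (n + 1) → ℤ, ((Wcoef q Y : ℝ) : ℂ) ≠ 0 := fun Y => by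
    exact_mod_cast (Wcoef_pos hq Y).ne'
  refine ((hfree X t ht).const_mul _).congr_deriv ?_
  rw [← Finset.sum_sub_distrib, ← Finset.sum_fiberwise_of_maps_to
    (fun j _ => Finset.mem_image_of_mem X (Finset.mem_univ j)), Finset.mul_sum]
  refine Finset.sum_congr rfl fun s hs => ?_
  obtain ⟨m, L, hmL, rfl, hF, hlow⟩ := exists_level_eq_Icc hX hs
  have hlevel : ∀ j, m ≤ j → j ≤ L → X j = X L := fun j h1 h2 => by
    have : j ∈ Finset.univ.filter (fun j => X j = X L) := hF ▸ Finset.mem_Icc.2 ⟨h1, h2⟩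
    exact (Finset.mem_filter.1 this).2
  have hgeom := one_sub_mul_sum_Icc_of_geometric (q : ℂ)
    (fun j => (b (X L - 1) : ℂ) * u0 (Function.update X j (X L - 1)) t
      - (b (X L) : ℂ) * u0 X t) hmL fun k h h1 h2 =>
        hbc.update_sub_eq h (hlevel _ h1 (by rw [Fin.le_def]; simp only; omega))
          (hlevel _ (by rw [Fin.le_def]; simp only; omega) h2) ht
  have hcard : (Finset.Icc m L).card = cnt X (X L) := by rw [← hF]; rfl
  have hsum : ∑ j ∈ Finset.univ.filter (fun j => X j = X L),
      ((b (X j - 1) : ℂ) * u0 (Function.update X j (X j - 1)) t - (b (X j) : ℂ) * u0 X t) =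
      (1 - (q : ℂ) ^ cnt X (X L)) *
        ((a (X L - 1) : ℂ) * u0 (Function.update X L (X L - 1)) t
          - (a (X L) : ℂ) * u0 X t) := by
    rw [hF, Finset.sum_congr rfl fun j hj => by
      rw [hlevel j (Finset.mem_Icc.1 hj).1 (Finset.mem_Icc.1 hj).2]]
    refine mul_left_cancel₀ hq1 (hgeom.trans ?_)
    rw [hcard, hb, hb]
    push_cast
    ring
  have hWmul : (Wcoef q (Function.update X L (X L - 1)) : ℂ) * (1 - (q : ℂ) ^ cnt X (X L)) =
      (Wcoef q X : ℂ) *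
        (1 - (q : ℂ) ^ cnt (Function.update X L (X L - 1)) (X L - 1)) := by
    exact_mod_cast Wcoef_update_mul (q := q) X L
  rw [hsum, hlow]
  have hWX := hW X
  have hWY := hW (Function.update X L (X L - 1))
  field_simp
  linear_combination (a (X L - 1) : ℂ) * u0 (Function.update X L (X L - 1)) t * hWmul
end

section
/- Let n ≥ 1 and suppose u⁰(X;·) : [0,∞) → ℂ, X ∈ ℤ^n, satisfies the boundary conditions. Let X ∈ ℤ^n, s ∈ ℤ, and suppose the coordinates p, p+1, …, r of X are all equal to s (for some 1 ≤ p ≤ r ≤ n). Then for every l with p ≤ l ≤ r and every t ≥ 0: b_{s−1} u⁰(X^{l,−};t) = q^{r−l} b_{s−1} u⁰(X^{r,−};t) + (1 − q^{r−l}) b_s u⁰(X;t). -/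
/-- The boundary condition between neighbouring positions `k` and `k + 1` at which `X`
takes the common value `s`. -/
lemma BoundaryCond.lower_eq {q : ℝ} {b : ℤ → ℝ} {n : ℕ} {u : (Fin n → ℤ) → ℝ → ℂ}
    (hu : BoundaryCond q b u) {X : Fin n → ℤ} {s : ℤ} {k : ℕ} (h : k + 1 < n)
    (hk : X ⟨k, by omega⟩ = s) (hk' : X ⟨k + 1, h⟩ = s) {t : ℝ} (ht : 0 ≤ t) :
    (b (s - 1) : ℂ) * u (Function.update X ⟨k, by omega⟩ (s - 1)) t =
      (q : ℂ) * (b (s - 1) : ℂ) * u (Function.update X ⟨k + 1, h⟩ (s - 1)) t +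
        (1 - (q : ℂ)) * (b s : ℂ) * u X t := by
  have hne : (⟨k + 1, h⟩ : Fin n) ≠ ⟨k, by omega⟩ := by simp
  have hleft : set2 X k h (s - 1) s = Function.update X ⟨k, by omega⟩ (s - 1) := by
    rw [set2, Function.update_eq_self_iff, Function.update_of_ne hne, hk']
  have hmid (v : ℤ) : set2 X k h s v = Function.update X ⟨k + 1, h⟩ v := by
    rw [set2, ← hk, Function.update_eq_self]
  have hright : set2 X k h s s = X := by
    rw [hmid, Function.update_eq_self_iff, hk']
  simpa only [hleft, hright, hmid] using hu k h X s t ht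

/-- iterated boundary condition on a block of equal coordinates. -/
theorem boundary_condition_iterated
    (q : ℝ) (hq : q ∈ Set.Ioo (0 : ℝ) 1) (a b : ℤ → ℝ)
    (ha : ∀ i, 0 < a i) (hb : ∀ i, b i = a i * (1 - q))
    (n : ℕ) (u0 : (Fin (n + 1) → ℤ) → ℝ → ℂ) (hbc : BoundaryCond q b u0)
    (X : Fin (n + 1) → ℤ) (s : ℤ) (p r : Fin (n + 1)) (hpr : p ≤ r)
    (hconst : ∀ j, p ≤ j → j ≤ r → X j = s)
    (l : Fin (n + 1)) (hpl : p ≤ l) (hlr : l ≤ r) (t : ℝ) (ht : 0 ≤ t) :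
    (b (s - 1) : ℂ) * u0 (Function.update X l (X l - 1)) t =
      (q : ℂ) ^ ((r : ℕ) - (l : ℕ)) * (b (s - 1) : ℂ) *
          u0 (Function.update X r (X r - 1)) t +
        (1 - (q : ℂ) ^ ((r : ℕ) - (l : ℕ))) * (b s : ℂ) * u0 X t := by
  have hblock (d : ℕ) : ∀ l : Fin (n + 1), p ≤ l → (l : ℕ) + d = r →
      (b (s - 1) : ℂ) * u0 (Function.update X l (s - 1)) t =
        (q : ℂ) ^ d * (b (s - 1) : ℂ) * u0 (Function.update X r (s - 1)) t +
          (1 - (q : ℂ) ^ d) * (b s : ℂ) * u0 X t := by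
    induction d with
    | zero =>
      intro l _ hl
      obtain rfl : l = r := Fin.ext hl
      simp
    | succ d ih =>
      intro l hpl hl
      have hr := r.isLt
      have hlt : (l : ℕ) + 1 < n + 1 := by omega
      rw [Fin.le_def] at hpl
      have hstep := hbc.lower_eq hlt (hconst l hpl (Fin.le_def.2 (by omega)))
        (hconst ⟨l + 1, hlt⟩ (Fin.le_def.2 (by simp; omega)) (Fin.le_def.2 (by simp; omega))) ht
      have hnext := ih ⟨l + 1, hlt⟩ (Fin.le_def.2 (by simp; omega)) (by simp; omega)
      linear_combination hstep + (q : ℂ) * hnext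
  rw [hconst l hpl hlr, hconst r hpr le_rfl]
  exact hblock _ l hpl (Nat.add_sub_cancel' hlr)
end
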